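/- arXiv:2107.10310 — 2 statements merged into one kernel-verified Lean document; each statement's English description precedes it below -/
import Mathlib

section
/- Let 𝔽_q be a finite field of odd characteristic with q a square, and let φ ∈ 𝔽_q[x] be a polynomial of degree 2 whose unique finite critical point is strictly preperiodic (its forward orbit eventually enters a cycle but the point itself is not periodic). If φ is not Möbius-conjugate over the algebraic closure of 𝔽_q to the Chebyshev polynomial x² − 2, then the limit as k → ∞ of #Per(φ, ℙ¹(𝔽_{q^k}))/(q^k + 1) equals 0. -/
open Polynomial

open Classical in
/-- The self-map of `ℙ¹(Ω) = Ω ∪ {∞}` (modeled as `Option Ω`, with `none = ∞`)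
induced by the rational function `p/q`, where `p q : Polynomial Ω` are assumed coprime. -/
noncomputable def ratMapP1 {Ω : Type*} [Field Ω] (p q : Polynomial Ω) : Option Ω → Option Ω :=
  fun z => match z with
  | some a => if q.eval a = 0 then none else some (p.eval a / q.eval a)
  | none =>
      if q.natDegree < p.natDegree then none
      else if p.natDegree < q.natDegree then some 0
      else some (p.leadingCoeff / q.leadingCoeff)

open Classical in
/-- The Möbius transformation `z ↦ (a z + b)/(c z + d)` of `ℙ¹(Ω)`, for an
invertible matrix `(a b; c d)`. -/
noncomputable def mobiusMap {Ω : Type*} [Field Ω] (a b c d : Ω) : Option Ω → Option Ω :=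
  fun z => match z with
  | some x => if c * x + d = 0 then none else some ((a * x + b) / (c * x + d))
  | none => if c = 0 then none else some (a / c)

open Classical in
/-- The ramification index of the rational function `p/q` at a finite point `x`. -/
noncomputable def ramAt {Ω : Type*} [Field Ω] (p q : Polynomial Ω) (x : Ω) : ℕ :=
  if q.eval x = 0 then Polynomial.rootMultiplicity x q
  else Polynomial.rootMultiplicity x (p - C (p.eval x / q.eval x) * q)

/-- The ramification index `e_{p/q}(α)` of the rational function `p/q` at a point
`α ∈ ℙ¹(Ω)`; the index at `∞` is computed from the reversed polynomials. -/
noncomputable def ramIdxP1 {Ω : Type*} [Field Ω] (p q : Polynomial Ω) : Option Ω → ℕ :=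
  fun z => match z with
  | some x => ramAt p q x
  | none =>
      ramAt (p.reverse * X ^ (max p.natDegree q.natDegree - p.natDegree))
            (q.reverse * X ^ (max p.natDegree q.natDegree - q.natDegree)) 0

/-- The set of critical points in `ℙ¹(Ω)` of the rational function `p/q`. -/
def critSetP1 {Ω : Type*} [Field Ω] (p q : Polynomial Ω) : Set (Option Ω) :=
  {α | 1 < ramIdxP1 p q α}

/-- The post-critical set `P_φ = ⋃_{k ≥ 1} φ^k(C_φ)` of `φ = p/q`. -/
def postCritP1 {Ω : Type*} [Field Ω] (p q : Polynomial Ω) : Set (Option Ω) :=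
  ⋃ k : ℕ, (ratMapP1 p q)^[k + 1] '' critSetP1 p q

/-- `φ = p/q` is a Lattès map: there is `r : ℙ¹(Ω) → ℤ` with
`r(φ(α)) = e_φ(α) · r(α)` for all `α` and `r(α) = 1` outside the post-critical set. -/
def IsLattesPair {Ω : Type*} [Field Ω] (p q : Polynomial Ω) : Prop :=
  ∃ r : Option Ω → ℤ,
    (∀ α : Option Ω, r (ratMapP1 p q α) = ramIdxP1 p q α * r α) ∧
    ∀ α : Option Ω, α ∉ postCritP1 p q → r α = 1

/-- The rational maps `p/q` and `r/s` are Möbius-conjugate over `Ω`: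
`(r/s) ∘ μ = μ ∘ (p/q)` on `ℙ¹(Ω)` for some Möbius transformation `μ`. -/
def MobiusConjugate {Ω : Type*} [Field Ω] (p q r s : Polynomial Ω) : Prop :=
  ∃ a b c d : Ω, a * d - b * c ≠ 0 ∧
    ∀ z : Option Ω, ratMapP1 r s (mobiusMap a b c d z) = mobiusMap a b c d (ratMapP1 p q z)

/-- `φ = p/q` is dynamically exceptional: there is a finite nonempty
`Γ ⊆ ℙ¹(Ω)` with `φ⁻¹(Γ) \ C_φ = Γ`. -/
def DynExceptional {Ω : Type*} [Field Ω] (p q : Polynomial Ω) : Prop :=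
  ∃ Γ : Set (Option Ω), Γ.Finite ∧ Γ.Nonempty ∧
    (ratMapP1 p q) ⁻¹' Γ \ critSetP1 p q = Γ

/-- The number of points of `ℙ¹(𝔽_{q^N})` (realized inside `ℙ¹` of the algebraic
closure of `F`, where `q = #F`) that are periodic under the rational map `p/q`. -/
noncomputable def perCount (F : Type*) [Field F] [Fintype F] (p q : Polynomial F)
    (N : ℕ) : ℕ :=
  Set.ncard {α : Option (AlgebraicClosure F) |
    (α = none ∨ ∃ a : AlgebraicClosure F, α = some a ∧ a ^ Fintype.card F ^ N = a) ∧
    ∃ m : ℕ, 1 ≤ m ∧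
      (ratMapP1 (p.map (algebraMap F (AlgebraicClosure F)))
        (q.map (algebraMap F (AlgebraicClosure F))))^[m] α = α}

open Polynomial

/-- Coefficients of the power series square root with prescribed constant term. -/
noncomputable def sqrtCoeff {K : Type*} [Field K] (g : PowerSeries K) (y₀ : K) : ℕ → K
  | 0 => y₀
  | n + 1 => (PowerSeries.coeff (n + 1) g -
      ∑ i : Fin n, sqrtCoeff g y₀ (i + 1) * sqrtCoeff g y₀ (n - i)) / (2 * y₀)
decreasing_by all_goals omega

theorem exists_powerSeries_sq_eq {K : Type*} [Field K] (h2 : (2 : K) ≠ 0) (g : PowerSeries K)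
    (y₀ : K) (hy : y₀ ≠ 0) (hg : PowerSeries.constantCoeff g = y₀ ^ 2) :
    ∃ y : PowerSeries K, y ^ 2 = g := by
  refine ⟨PowerSeries.mk (sqrtCoeff g y₀), ?_⟩
  ext n
  rw [pow_two, PowerSeries.coeff_mul]
  simp only [PowerSeries.coeff_mk]
  rw [Finset.Nat.sum_antidiagonal_eq_sum_range_succ
    (fun i j => sqrtCoeff g y₀ i * sqrtCoeff g y₀ j)]
  cases n with
  | zero => simp [sqrtCoeff, hg, pow_two]
  | succ n =>
    rw [Finset.sum_range_succ, Finset.sum_range_succ']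
    have hm : ∑ k ∈ Finset.range n, sqrtCoeff g y₀ (k + 1) * sqrtCoeff g y₀ (n + 1 - (k + 1)) =
        ∑ i : Fin n, sqrtCoeff g y₀ (i + 1) * sqrtCoeff g y₀ (n - i) := by
      rw [Finset.sum_range]
      simp
    have h0 : sqrtCoeff g y₀ 0 = y₀ := by rw [sqrtCoeff]
    have h1 : sqrtCoeff g y₀ (n + 1) * (2 * y₀) = PowerSeries.coeff (n + 1) g -
        ∑ i : Fin n, sqrtCoeff g y₀ (i + 1) * sqrtCoeff g y₀ (n - i) := by
      conv_lhs => rw [sqrtCoeff]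
      field_simp
    rw [hm]
    simp only [h0, Nat.sub_self, Nat.sub_zero]
    linear_combination h1

universe u

/-- An affine curve over `Ω` with a filtration of linear growth and Frobenius endomorphisms. -/
structure FrobCurve (Ω : Type u) [Field Ω] (q : ℕ) where
  A : Type u
  [commRing : CommRing A]
  [isDomain : IsDomain A]
  [algebra : Algebra Ω A]
  z : A
  D : ℕ → Submodule Ω A
  d : ℕ
  e : ℕ
  d_pos : 0 < d
  D_mono : Monotone D
  D_fin : ∀ n, FiniteDimensional Ω (D n)
  D_rank : ∀ n, Module.finrank Ω (D n) = d * n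
  D_exh : ∀ x, ∃ n, x ∈ D n
  D_mul : ∀ m n x y, x ∈ D m → y ∈ D n → x * y ∈ D (m + n + e)
  fr : ℕ → A →+* A
  fr_alg : ∀ k a, fr k (algebraMap Ω A a) = algebraMap Ω A (a ^ q ^ k)
  fr_z : ∀ k, fr k z = z
  fr_surj : ∀ k n x, x ∈ D n → ∃ y ∈ D n, fr k y = x

namespace FrobCurve

attribute [instance] commRing isDomain algebra D_fin

variable {Ω : Type u} [Field Ω] {q : ℕ} (C : FrobCurve Ω q)

theorem exists_dual (S : Finset (C.A →ₐ[Ω] Ω)) (α : C.A →ₐ[Ω] Ω) :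
    ∃ u : C.A, α u = 1 ∧ ∀ β ∈ S, β ≠ α → β u = 0 := by
  classical
  have hx : ∀ β : C.A →ₐ[Ω] Ω, ∃ x : C.A, β ≠ α → β x ≠ α x := by
    intro β
    by_cases h : β = α
    · exact ⟨0, fun h' => absurd h h'⟩
    · by_contra! hc
      exact h (AlgHom.ext fun x => (hc x).2)
  choose x hx using hx
  set w : C.A := ∏ β ∈ S.erase α, (x β - algebraMap Ω C.A (β (x β))) with hw
  have hαw : α w ≠ 0 := by
    rw [hw, map_prod, Finset.prod_ne_zero_iff]
    intro β hβ
    have := hx β (Finset.ne_of_mem_erase hβ)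
    simp only [map_sub, AlgHom.commutes, Algebra.algebraMap_self, RingHom.id_apply]
    exact sub_ne_zero.2 this.symm
  refine ⟨(α w)⁻¹ • w, by simp [hαw], ?_⟩
  intro β hβ hne
  have : β w = 0 := by
    rw [hw, map_prod]
    refine Finset.prod_eq_zero (Finset.mem_erase.2 ⟨hne, hβ⟩) ?_
    simp
  simp [this]

theorem card_zeros_le (θ : C.A) (hθ : θ ≠ 0) (n₀ : ℕ) (hn : θ ∈ C.D n₀)
    (S : Finset (C.A →ₐ[Ω] Ω)) (hS : ∀ α ∈ S, α θ = 0) : S.card ≤ C.d * (n₀ + C.e) := by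
  classical
  have hu := fun α => C.exists_dual S α
  choose u hu1 hu2 using hu
  have hN := fun α => C.D_exh (u α)
  choose N hN using hN
  set n := S.sup N with hn'
  have hun : ∀ α ∈ S, u α ∈ C.D (n + n₀ + C.e) := fun α hα =>
    C.D_mono ((Finset.le_sup (f := N) hα).trans (by omega)) (hN α)
  let E : C.D (n + n₀ + C.e) →ₗ[Ω] (S → Ω) :=
    (LinearMap.pi fun α : S => α.1.toLinearMap).comp (C.D (n + n₀ + C.e)).subtype
  have hE : Function.Surjective E := by
    intro c
    refine ⟨⟨∑ α : S, c α • u α, Submodule.sum_mem _ fun α _ =>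
      Submodule.smul_mem _ _ (hun α α.2)⟩, ?_⟩
    ext β
    simp only [E, LinearMap.comp_apply, LinearMap.pi_apply, Submodule.subtype_apply,
      AlgHom.toLinearMap_apply, map_sum, map_smul, smul_eq_mul]
    rw [Finset.sum_eq_single β]
    · rw [hu1, mul_one]
    · intro α _ hne
      rw [hu2 α β β.2 (fun h => hne (Subtype.ext h.symm)), mul_zero]
    · simp
  let M : C.D n →ₗ[Ω] LinearMap.ker E :=
    LinearMap.codRestrict _ (LinearMap.codRestrict _
      ((LinearMap.mulLeft Ω θ).comp (C.D n).subtype) (fun x => by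
        have := C.D_mul _ _ _ _ hn x.2
        rw [add_comm n₀ n] at this
        exact this)) (fun x => by
        rw [LinearMap.mem_ker]
        ext β
        change β.1 (θ * x.1) = 0
        rw [map_mul, hS β β.2, zero_mul])
  have hM : Function.Injective M := by
    intro x y hxy
    have : θ * x.1 = θ * y.1 := congrArg (fun t => t.1.1) hxy
    exact Subtype.ext (mul_left_cancel₀ hθ this)
  have h1 := LinearMap.finrank_le_finrank_of_injective hM
  have h2 := LinearMap.finrank_range_add_finrank_ker E
  rw [LinearMap.range_eq_top.2 hE, finrank_top, Module.finrank_fintype_fun_eq_card,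
    Fintype.card_coe, C.D_rank] at h2
  rw [C.D_rank] at h1
  have : C.d * (n + n₀ + C.e) = C.d * n + C.d * (n₀ + C.e) := by ring
  omega

end FrobCurve

namespace FrobCurve

variable {Ω : Type u} [Field Ω] {q : ℕ} (C : FrobCurve Ω q)

theorem pow_mem_D {l : ℕ} {v : C.A} (hv : v ∈ C.D l) {s : ℕ} (hs : 1 ≤ s) :
    v ^ s ∈ C.D (s * (l + C.e)) := by
  induction s, hs using Nat.le_induction with
  | base => simpa using C.D_mono (Nat.le_add_right l C.e) hv
  | succ s _ ih =>
    have := C.D_mul _ _ _ _ ih hv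
    rw [pow_succ]
    convert this using 2
    ring

/-- In a finite-dimensional piece of the filtration, high order vanishing forces vanishing. -/
theorem exists_order_bound (ψ : C.A →ₐ[Ω] PowerSeries Ω) (hψ : Function.Injective ψ) (l : ℕ) :
    ∃ n, ∀ s, n ≤ s → ∀ v ∈ C.D l, (PowerSeries.X : PowerSeries Ω) ^ s ∣ ψ v → v = 0 := by
  let I : ℕ → Submodule Ω (PowerSeries Ω) := fun n =>
    (Ideal.span {(PowerSeries.X : PowerSeries Ω) ^ n}).restrictScalars Ω
  let W : ℕ →o (Submodule Ω (C.D l))ᵒᵈ :=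
    ⟨fun n => OrderDual.toDual ((I n).comap (ψ.toLinearMap.comp (C.D l).subtype)), by
      intro m n hmn
      change Submodule.comap _ (I n) ≤ Submodule.comap _ (I m)
      refine Submodule.comap_mono ?_
      intro x hx
      simp only [I, Submodule.restrictScalars_mem, Ideal.mem_span_singleton] at hx ⊢
      exact (pow_dvd_pow _ hmn).trans hx⟩
  obtain ⟨n, hn⟩ := IsArtinian.monotone_stabilizes W
  have hmem : ∀ m (v : C.D l), v ∈ OrderDual.ofDual (W m) ↔
      (PowerSeries.X : PowerSeries Ω) ^ m ∣ ψ v := by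
    intro m v
    change ψ v ∈ Ideal.span {(PowerSeries.X : PowerSeries Ω) ^ m} ↔ _
    rw [Ideal.mem_span_singleton]
  refine ⟨n, fun s hs v hv hd => ?_⟩
  have hall : ∀ m, n ≤ m → (PowerSeries.X : PowerSeries Ω) ^ m ∣ ψ v := by
    intro m hm
    refine (hmem m ⟨v, hv⟩).1 ?_
    rw [← hn m hm, hn s hs]
    exact (hmem s ⟨v, hv⟩).2 hd
  apply hψ
  rw [map_zero]
  ext m
  have := hall (max n (m + 1)) (le_max_left _ _)
  rw [PowerSeries.X_pow_dvd_iff] at this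
  simpa using this m (by omega)

theorem card_le_of_linear_system {p : ℕ} [Fact p.Prime] [CharP Ω p]
    (ψ : C.A →ₐ[Ω] PowerSeries Ω) (hψ : Function.Injective ψ) (l n : ℕ)
    (hn : ∀ s, n ≤ s → ∀ v ∈ C.D l, (PowerSeries.X : PowerSeries Ω) ^ s ∣ ψ v → v = 0)
    (m a : ℕ) (hns : n ≤ p ^ a)
    (hm : p ^ a * (l + C.e) + m + C.e < C.d * l * m)
    (φ : C.A →+* C.A) (hφ : ∀ x ∈ C.D m, ∃ y ∈ C.D m, φ y = x)
    (S : Finset (C.A →ₐ[Ω] Ω)) (hS : ∀ α ∈ S, ∀ w, α (φ w) = α w ^ (p ^ a) ^ 2) :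
    S.card ≤ C.d * (l + p ^ a * (m + C.e) + C.e + C.e) := by
  classical
  have hp : p.Prime := Fact.out
  have : CharP C.A p := charP_of_injective_algebraMap (algebraMap Ω C.A).injective p
  have : CharP (PowerSeries Ω) p :=
    charP_of_injective_algebraMap (algebraMap Ω (PowerSeries Ω)).injective p
  set s := p ^ a with hs
  have hs1 : 1 ≤ s := Nat.one_le_pow _ _ hp.pos
  let b := Module.finBasis Ω (C.D l)
  set N := Module.finrank Ω (C.D l) with hN
  let v : Fin N → C.A := fun i => b i
  have hv : ∀ i, v i ∈ C.D l := fun i => (b i).2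
  let L : (Fin N → C.D m) →ₗ[Ω] C.D (s * (l + C.e) + m + C.e) :=
    ∑ i, (LinearMap.codRestrict _ ((LinearMap.mulLeft Ω (v i ^ s)).comp (C.D m).subtype)
      (fun x => C.D_mul _ _ _ _ (C.pow_mem_D (hv i) hs1) x.2)).comp (LinearMap.proj i)
  have hL : ∀ u, (L u : C.A) = ∑ i, v i ^ s * (u i : C.A) := by
    intro u
    simp only [L, LinearMap.sum_apply, AddSubmonoidClass.coe_finsetSum]
    rfl
  have hker : LinearMap.ker L ≠ ⊥ := by
    apply LinearMap.ker_ne_bot_of_finrank_lt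
    rw [Module.finrank_pi_fintype]
    simp only [C.D_rank, Finset.sum_const, Finset.card_univ, Fintype.card_fin, smul_eq_mul, hN]
    calc C.d * (s * (l + C.e) + m + C.e) < C.d * (C.d * l * m) :=
          Nat.mul_lt_mul_of_pos_left hm C.d_pos
      _ = _ := by ring
  obtain ⟨u, hu, hu0⟩ := (Submodule.ne_bot_iff _).1 hker
  have hsum : ∑ i, v i ^ s * (u i : C.A) = 0 := by
    rw [← hL, LinearMap.mem_ker.1 hu]
    rfl
  choose w hwD hw using fun i => hφ (u i) (u i).2
  obtain ⟨i₀, hi₀⟩ : ∃ i, w i ≠ 0 := by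
    by_contra! h
    apply hu0
    funext i
    apply Subtype.ext
    rw [← hw i, h i, map_zero]
    rfl
  set θ := ∑ i, v i * w i ^ s with hθdef
  have hθD : θ ∈ C.D (l + s * (m + C.e) + C.e) :=
    Submodule.sum_mem _ fun i _ => C.D_mul _ _ _ _ (hv i) (C.pow_mem_D (hwD i) hs1)
  have hθ : θ ≠ 0 := by
    intro h0
    -- divide by the minimal order
    have hne : (Finset.univ.filter fun i => w i ≠ 0).Nonempty := ⟨i₀, by simp [hi₀]⟩
    have hψ0 : ∀ i, w i ≠ 0 → ψ (w i) ≠ 0 := fun i hi h => hi (hψ (by rw [h, map_zero]))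
    obtain ⟨i₁, hi₁, hmin⟩ := Finset.exists_min_image _ (fun i => (ψ (w i)).order.toNat) hne
    set o := (ψ (w i₁)).order.toNat with ho
    have hdiv : ∀ i, ∃ g, ψ (w i) = PowerSeries.X ^ o * g := by
      intro i
      by_cases hi : w i = 0
      · exact ⟨0, by simp [hi]⟩
      · have h1 : o ≤ (ψ (w i)).order.toNat := hmin i (by simp [hi])
        have h2 := PowerSeries.X_pow_order_dvd (φ := ψ (w i))
        exact (pow_dvd_pow _ h1).trans h2
    choose g hg using hdiv
    have hg1 : PowerSeries.constantCoeff (g i₁) ≠ 0 := by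
      intro hc
      have hd : PowerSeries.X ∣ g i₁ := PowerSeries.X_dvd_iff.2 hc
      obtain ⟨t, ht⟩ := hd
      have hi₁' : w i₁ ≠ 0 := by simpa using hi₁
      have hX : (PowerSeries.X : PowerSeries Ω) ^ (o + 1) ∣ ψ (w i₁) :=
        ⟨t, by rw [hg i₁, ht]; ring⟩
      rw [PowerSeries.X_pow_dvd_iff] at hX
      have := PowerSeries.coeff_order (hψ0 i₁ hi₁')
      exact this (hX _ (by omega))
    have hfd : ∀ i, ∃ h, g i ^ s =
        PowerSeries.C (PowerSeries.constantCoeff (g i) ^ s) + PowerSeries.X ^ s * h := by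
      intro i
      have : PowerSeries.X ∣ g i - PowerSeries.C (PowerSeries.constantCoeff (g i)) := by
        rw [PowerSeries.X_dvd_iff]; simp
      obtain ⟨h, hh⟩ := this
      refine ⟨h ^ s, ?_⟩
      have h3 : g i = PowerSeries.C (PowerSeries.constantCoeff (g i)) + PowerSeries.X * h := by
        rw [← hh]; ring
      conv_lhs => rw [h3]
      rw [hs, add_pow_char_pow, map_pow, mul_pow]
    choose h hh using hfd
    have h1 : ψ θ = PowerSeries.X ^ (o * s) * ∑ i, ψ (v i) * g i ^ s := by
      rw [hθdef, map_sum, Finset.mul_sum]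
      refine Finset.sum_congr rfl fun i _ => ?_
      rw [map_mul, map_pow, hg i]
      ring
    have h2 : ∑ i, ψ (v i) * g i ^ s = 0 := by
      rw [h0, map_zero] at h1
      exact (mul_eq_zero.1 h1.symm).resolve_left (pow_ne_zero _ PowerSeries.X_ne_zero)
    set ω : Fin N → Ω := fun i => PowerSeries.constantCoeff (g i) ^ s with hω
    have h3 : (PowerSeries.X : PowerSeries Ω) ^ s ∣ ψ (∑ i, ω i • v i) := by
      refine ⟨-∑ i, ψ (v i) * h i, ?_⟩
      have : ψ (∑ i, ω i • v i) = ∑ i, ψ (v i) * g i ^ s -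
          PowerSeries.X ^ s * ∑ i, ψ (v i) * h i := by
        rw [map_sum, Finset.mul_sum, ← Finset.sum_sub_distrib]
        refine Finset.sum_congr rfl fun i _ => ?_
        rw [map_smul, hh i, PowerSeries.smul_eq_C_mul]
        ring
      rw [this, h2]; ring
    have h4 := hn s hns _ (Submodule.sum_mem _ fun i _ => Submodule.smul_mem _ (ω i) (hv i)) h3
    have h5 : ∑ i, ω i • b i = 0 := Subtype.ext (by simpa [v] using h4)
    have h6 := Fintype.linearIndependent_iff.1 b.linearIndependent ω h5 i₁
    exact hg1 (pow_eq_zero_iff (by omega) |>.1 h6)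
  refine C.card_zeros_le θ hθ _ hθD S fun α hα => ?_
  have : α θ ^ s = 0 := by
    have h7 : α θ ^ s = α (∑ i, v i ^ s * (u i : C.A)) := by
      rw [hθdef, map_sum, hs, sum_pow_char_pow, map_sum]
      refine Finset.sum_congr rfl fun i _ => ?_
      rw [map_mul, map_mul, ← hw i, hS α hα, map_pow, map_pow, ← hs]
      ring
    rw [h7, hsum, map_zero]
  exact pow_eq_zero_iff (by omega) |>.1 this

/-- Stepanov's bound: asymptotically at most `(1 + ε) s ^ 2` points. -/
theorem card_points_le {p : ℕ} [Fact p.Prime] [CharP Ω p]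
    (ψ : C.A →ₐ[Ω] PowerSeries Ω) (hψ : Function.Injective ψ) (ε : ℝ) (hε : 0 < ε) :
    ∃ s₀ : ℕ, ∀ a : ℕ, s₀ ≤ p ^ a → ∀ φ : C.A →+* C.A,
      (∀ m, ∀ x ∈ C.D m, ∃ y ∈ C.D m, φ y = x) → ∀ S : Finset (C.A →ₐ[Ω] Ω),
      (∀ α ∈ S, ∀ w, α (φ w) = α w ^ (p ^ a) ^ 2) →
      (S.card : ℝ) ≤ (1 + ε) * ((p : ℝ) ^ a) ^ 2 := by
  have hd : (1 : ℝ) ≤ C.d := by exact_mod_cast C.d_pos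
  have hd0 : (0 : ℝ) < C.d := by linarith
  -- choose `l`
  obtain ⟨l, hl⟩ : ∃ l : ℕ, 2 ≤ l ∧ 2 * ((C.d : ℝ) * C.e + 1) ≤ ε * ((l : ℝ) * C.d - 1) := by
    obtain ⟨l, hl⟩ := exists_nat_ge ((2 * ((C.d : ℝ) * C.e + 1) / ε + 1) + 2)
    refine ⟨l, ?_, ?_⟩
    · have h1 : (0:ℝ) ≤ 2 * ((C.d : ℝ) * C.e + 1) / ε + 1 := by positivity
      have : (2 : ℝ) ≤ l := by linarith
      exact_mod_cast this
    · have h1 : 2 * ((C.d : ℝ) * C.e + 1) / ε ≤ (l : ℝ) * C.d - 1 := by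
        nlinarith
      rw [div_le_iff₀ hε] at h1
      linarith
  obtain ⟨hl2, hl⟩ := hl
  obtain ⟨n, hn⟩ := C.exists_order_bound ψ hψ l
  have hT1 : 1 ≤ C.d * l - 1 := by
    have := C.d_pos
    have : 2 ≤ C.d * l := by nlinarith
    omega
  set T := C.d * l - 1 with hT
  have hTl : C.d * l = T + 1 := by omega
  set B : ℝ := C.d * (2 * C.e + 1 + l + 2 * C.e) with hB
  obtain ⟨s₁, hs₁⟩ := exists_nat_ge (2 * B / ε)
  refine ⟨max (max n s₁) 1, fun a ha φ hφ S hS => ?_⟩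
  set s := p ^ a with hs
  have hs1 : 1 ≤ s := le_trans (le_max_right _ _) ha
  have hns : n ≤ s := le_trans (le_trans (le_max_left _ _) (le_max_left _ _)) ha
  have hss : s₁ ≤ s := le_trans (le_trans (le_max_right _ _) (le_max_left _ _)) ha
  set m := (s * (l + C.e) + C.e) / T + 1 with hm
  have hmlt : s * (l + C.e) + C.e < T * m := by
    rw [hm]
    exact Nat.lt_mul_div_succ _ hT1
  have hmle : T * m ≤ s * (l + C.e) + C.e + T := by
    have := Nat.mul_div_le (s * (l + C.e) + C.e) T
    rw [hm, mul_add, mul_one]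
    omega
  have key := C.card_le_of_linear_system ψ hψ l n hn m a hns
    (by rw [hTl, add_mul, one_mul, ← hs]; omega) φ (hφ m) S hS
  rw [← hs] at key
  have keyR : (S.card : ℝ) ≤ C.d * (l + s * (m + C.e) + C.e + C.e) := by exact_mod_cast key
  have hmR : (T : ℝ) * m ≤ s * (l + C.e) + C.e + T := by exact_mod_cast hmle
  have hTR : (C.d : ℝ) * l = T + 1 := by exact_mod_cast hTl
  have hT1R : (1 : ℝ) ≤ T := by exact_mod_cast hT1
  have hs1R : (1 : ℝ) ≤ s := by exact_mod_cast hs1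
  have hssR : 2 * B / ε ≤ s := hs₁.trans (by exact_mod_cast hss)
  have hBs : 2 * B ≤ ε * s := by rw [div_le_iff₀ hε] at hssR; linarith
  have heps : 2 * ((C.d : ℝ) * C.e + 1) ≤ ε * T := by
    have : (l : ℝ) * C.d - 1 = T := by rw [mul_comm, hTR]; ring
    rwa [this] at hl
  have he0 : (0 : ℝ) ≤ C.e := Nat.cast_nonneg _
  -- d * m ≤ s (1 + ε/2) + d (e + 1)
  have hdm : (C.d : ℝ) * m ≤ s * (1 + ε / 2) + C.d * (C.e + 1) := by
    have h1 : (T : ℝ) * (C.d * m) ≤ T * (s * (1 + ε / 2) + C.d * (C.e + 1)) := by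
      have e1 : (C.d : ℝ) * (T * m) ≤ C.d * (s * (l + C.e) + C.e + T) :=
        mul_le_mul_of_nonneg_left hmR hd0.le
      have e2 : (C.d : ℝ) * (s * (l + C.e)) = s * (T + 1 + C.d * C.e) := by
        rw [← hTR]; ring
      have e3 : (s : ℝ) * (2 * (C.d * C.e + 1)) ≤ s * (ε * T) :=
        mul_le_mul_of_nonneg_left heps (by linarith)
      have e4 : (C.d : ℝ) * C.e ≤ T * (C.d * C.e) :=
        le_mul_of_one_le_left (by positivity) hT1R
      nlinarith
    exact le_of_mul_le_mul_left h1 (by linarith)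
  have hpa : ((p : ℝ) ^ a) = s := by rw [hs]; push_cast; rfl
  rw [hpa]
  calc (S.card : ℝ) ≤ C.d * (l + s * (m + C.e) + C.e + C.e) := keyR
    _ = s * (C.d * m) + s * (C.d * C.e) + C.d * (l + 2 * C.e) := by ring
    _ ≤ s * (s * (1 + ε / 2) + C.d * (C.e + 1)) + s * (C.d * C.e)
        + s * (C.d * (l + 2 * C.e)) := by
        have f1 := mul_le_mul_of_nonneg_left hdm (by linarith : (0:ℝ) ≤ s)
        have f2 : (C.d : ℝ) * (l + 2 * C.e) ≤ s * (C.d * (l + 2 * C.e)) :=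
          le_mul_of_one_le_left (by positivity) hs1R
        linarith
    _ = (1 + ε / 2) * s ^ 2 + s * B := by rw [hB]; ring
    _ ≤ (1 + ε) * s ^ 2 := by nlinarith

end FrobCurve

/-- `h` is not a square in the fraction field of `A`, and is nonzero. -/
def NonSq {A : Type*} [CommRing A] (h : A) : Prop := ∀ x y : A, x ^ 2 = h * y ^ 2 → y = 0

namespace QuadraticAlgebra

variable {A B : Type*} [CommRing A] [CommRing B] {h : A}

theorem isDomain_of_nonSq [IsDomain A] (hh : NonSq h) : IsDomain (QuadraticAlgebra A h 0) := by
  have key : ∀ w : QuadraticAlgebra A h 0, w.norm = 0 → w = 0 := by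
    intro w hw
    rw [norm_def] at hw
    have h1 : w.im = 0 := hh w.re w.im (by linear_combination hw)
    rw [h1] at hw
    have h2 : w.re = 0 := by
      have : w.re * w.re = 0 := by linear_combination hw
      simpa using this
    ext <;> simp [h1, h2]
  have : NoZeroDivisors (QuadraticAlgebra A h 0) := ⟨by
    intro a b hab
    have : a.norm * b.norm = 0 := by rw [← map_mul, hab, norm_zero]
    rcases mul_eq_zero.1 this with h1 | h1
    · exact Or.inl (key a h1)
    · exact Or.inr (key b h1)⟩
  exact NoZeroDivisors.to_isDomain _

/-- The ring homomorphism out of `A[√h]` determined by a square root of the image of `h`. -/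
def sqrtLift (α : A →+* B) (y : B) (hy : y ^ 2 = α h) : QuadraticAlgebra A h 0 →+* B where
  toFun w := α w.re + α w.im * y
  map_zero' := by simp
  map_one' := by
    rw [re_one, im_one]; simp
  map_add' v w := by simp only [re_add, im_add, map_add]; ring
  map_mul' v w := by
    simp only [re_mul, im_mul, map_add, map_mul, map_zero]
    linear_combination (-(α v.im * α w.im)) * hy

theorem sqrtLift_apply (α : A →+* B) (y : B) (hy : y ^ 2 = α h) (w : QuadraticAlgebra A h 0) :
    sqrtLift α y hy w = α w.re + α w.im * y := rfl

theorem sqrtLift_injective [IsDomain B] (hh : NonSq h) (α : A →+* B)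
    (hα : Function.Injective α) (y : B) (hy : y ^ 2 = α h) :
    Function.Injective (sqrtLift α y hy) := by
  rw [injective_iff_map_eq_zero]
  intro w hw
  rw [sqrtLift_apply] at hw
  have h1 : w.im = 0 := hh w.re w.im (hα (by
    rw [map_pow, map_mul, map_pow, ← hy]
    linear_combination (α w.re - α w.im * y) * hw))
  have h2 : w.re = 0 := by
    rw [h1, map_zero, zero_mul, add_zero] at hw
    exact hα (by rw [hw, map_zero])
  ext <;> simp [h1, h2]

variable {R : Type*} [CommRing R] [Algebra R A] [Algebra R B]

/-- The algebra version of `sqrtLift`. -/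
def sqrtLiftAlg (α : A →ₐ[R] B) (y : B) (hy : y ^ 2 = α h) :
    QuadraticAlgebra A h 0 →ₐ[R] B :=
  { sqrtLift (α : A →+* B) y hy with
    commutes' := fun r => by
      change α (algebraMap R A r) + α 0 * y = _
      simp }

theorem sqrtLiftAlg_apply (α : A →ₐ[R] B) (y : B) (hy : y ^ 2 = α h)
    (w : QuadraticAlgebra A h 0) : sqrtLiftAlg α y hy w = α w.re + α w.im * y := rfl

/-- Inclusion of the base ring. -/
def inclAlg (R : Type*) [CommRing R] [Algebra R A] (h : A) : A →ₐ[R] QuadraticAlgebra A h 0 :=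
  { algebraMap A (QuadraticAlgebra A h 0) with
    commutes' := fun _ => rfl }

theorem inclAlg_apply (x : A) : inclAlg R h x = ⟨x, 0⟩ := rfl

theorem omega_sq : (omega : QuadraticAlgebra A h 0) ^ 2 = inclAlg R h h := by
  rw [pow_two, omega_mul_omega_eq_mk, inclAlg_apply]

/-- A Frobenius on `A[√h]` extending one on `A`, sending `√h` to `σ √h` with `σ = ±1`. -/
def frExt (f : A →+* A) (hf : f h = h) (σ : ℤˣ) :
    QuadraticAlgebra A h 0 →+* QuadraticAlgebra A h 0 :=
  sqrtLift ((algebraMap A (QuadraticAlgebra A h 0)).comp f)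
    (((σ : ℤ) : QuadraticAlgebra A h 0) * omega) (by
    have : ((σ : ℤ) : QuadraticAlgebra A h 0) ^ 2 = 1 := by
      rw [← Int.cast_pow, ← Units.val_pow_eq_pow_val]; simp
    rw [mul_pow, this, one_mul, pow_two, omega_mul_omega_eq_mk, RingHom.comp_apply, hf]; rfl)

theorem frExt_apply (f : A →+* A) (hf : f h = h) (σ : ℤˣ) (w : QuadraticAlgebra A h 0) :
    frExt f hf σ w = ⟨f w.re, (σ : ℤ) * f w.im⟩ := by
  rw [frExt, sqrtLift_apply]
  rcases Int.units_eq_one_or σ with rfl | rfl <;> ext <;> simp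

end QuadraticAlgebra

namespace FrobCurve

variable {Ω : Type u} [Field Ω] {q : ℕ} (C : FrobCurve Ω q)

/-- The filtration on `A[√h]`. -/
def sqrtD (h : C.A) (n : ℕ) : Submodule Ω (QuadraticAlgebra C.A h 0) where
  carrier := {w | w.re ∈ C.D n ∧ w.im ∈ C.D n}
  zero_mem' := ⟨zero_mem _, zero_mem _⟩
  add_mem' ha hb := ⟨add_mem ha.1 hb.1, add_mem ha.2 hb.2⟩
  smul_mem' c _ ha := ⟨Submodule.smul_mem _ c ha.1, Submodule.smul_mem _ c ha.2⟩

/-- The filtration on `A[√h]` as a product. -/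
def sqrtDEquiv (h : C.A) (n : ℕ) : C.sqrtD h n ≃ₗ[Ω] C.D n × C.D n where
  toFun w := (⟨w.1.re, w.2.1⟩, ⟨w.1.im, w.2.2⟩)
  map_add' _ _ := rfl
  map_smul' _ _ := rfl
  invFun v := ⟨⟨v.1, v.2⟩, v.1.2, v.2.2⟩
  left_inv _ := rfl
  right_inv _ := rfl

theorem frExt_surj (h : C.A) (f : C.A →+* C.A) (hf : f h = h)
    (hs : ∀ n, ∀ x ∈ C.D n, ∃ y ∈ C.D n, f y = x) (σ : ℤˣ) (n : ℕ)
    (x : QuadraticAlgebra C.A h 0) (hx : x ∈ C.sqrtD h n) :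
    ∃ y ∈ C.sqrtD h n, QuadraticAlgebra.frExt f hf σ y = x := by
  obtain ⟨a, ha, hfa⟩ := hs n _ hx.1
  obtain ⟨b, hb, hfb⟩ := hs n _ hx.2
  rcases Int.units_eq_one_or σ with rfl | rfl
  · exact ⟨⟨a, b⟩, ⟨ha, hb⟩, by rw [QuadraticAlgebra.frExt_apply]; ext <;> simp [hfa, hfb]⟩
  · exact ⟨⟨a, -b⟩, ⟨ha, neg_mem hb⟩, by
      rw [QuadraticAlgebra.frExt_apply]; ext <;> simp [hfa, hfb]⟩

/-- Adjoining a square root to a curve. -/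
noncomputable def sqrt (h : C.A) (hfr : ∀ k, C.fr k h = h) (hh : NonSq h) : FrobCurve Ω q where
  A := QuadraticAlgebra C.A h 0
  isDomain := QuadraticAlgebra.isDomain_of_nonSq hh
  z := QuadraticAlgebra.inclAlg Ω h C.z
  D := C.sqrtD h
  d := 2 * C.d
  e := (C.D_exh h).choose + C.e + C.e
  d_pos := by have := C.d_pos; omega
  D_mono := fun _ _ hmn _ hw => ⟨C.D_mono hmn hw.1, C.D_mono hmn hw.2⟩
  D_fin := fun n => Module.Finite.equiv (C.sqrtDEquiv h n).symm
  D_rank := fun n => by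
    rw [(C.sqrtDEquiv h n).finrank_eq, Module.finrank_prod, C.D_rank]; ring
  D_exh := fun x => by
    obtain ⟨m, hm⟩ := C.D_exh x.re
    obtain ⟨n, hn⟩ := C.D_exh x.im
    exact ⟨max m n, C.D_mono (le_max_left _ _) hm, C.D_mono (le_max_right _ _) hn⟩
  D_mul := fun m n x y hx hy => by
    have hN := (C.D_exh h).choose_spec
    set N := (C.D_exh h).choose
    have hle : m + n + C.e ≤ m + n + (N + C.e + C.e) := by omega
    refine ⟨?_, ?_⟩
    · rw [QuadraticAlgebra.re_mul, mul_assoc]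
      refine add_mem (C.D_mono hle (C.D_mul _ _ _ _ hx.1 hy.1)) (C.D_mono ?_
        (C.D_mul _ _ _ _ hN (C.D_mul _ _ _ _ hx.2 hy.2)))
      omega
    · rw [QuadraticAlgebra.im_mul, zero_mul, zero_mul, add_zero]
      exact C.D_mono hle (add_mem (C.D_mul _ _ _ _ hx.1 hy.2) (C.D_mul _ _ _ _ hx.2 hy.1))
  fr := fun k => QuadraticAlgebra.frExt (C.fr k) (hfr k) 1
  fr_alg := fun k a => by
    rw [QuadraticAlgebra.frExt_apply]
    have h1 : ∀ b, algebraMap Ω (QuadraticAlgebra C.A h 0) b = ⟨algebraMap Ω C.A b, 0⟩ :=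
      fun _ => rfl
    rw [h1, h1]
    ext <;> simp [C.fr_alg]
  fr_z := fun k => by
    rw [QuadraticAlgebra.frExt_apply, QuadraticAlgebra.inclAlg_apply]
    ext <;> simp [C.fr_z]
  fr_surj := fun k n x hx => C.frExt_surj h (C.fr k) (hfr k) (C.fr_surj k) 1 n x hx

/-- Rational points over the degree `k` extension. -/
def IsPt (k : ℕ) (α : C.A →ₐ[Ω] Ω) : Prop := ∀ w, α (C.fr k w) = α w ^ q ^ k

/-- A curve has asymptotically at least `q ^ k` points. -/
def ManyPts : Prop := ∀ ε : ℝ, 0 < ε → ∃ K : ℕ, ∀ k, K ≤ k → ∃ S : Finset (C.A →ₐ[Ω] Ω),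
  (∀ α ∈ S, C.IsPt k α) ∧ (1 - ε) * (q : ℝ) ^ k ≤ S.card

/-- The curve has a point where it embeds in a formal disc. -/
def Embeds : Prop := ∃ ψ : C.A →ₐ[Ω] PowerSeries Ω, Function.Injective ψ

variable {p : ℕ} [Fact p.Prime] [CharP Ω p]

theorem card_twisted_le (a : ℕ) (ha : 1 ≤ a) (hq : q = (p ^ a) ^ 2) (hC : C.Embeds)
    (ε : ℝ) (hε : 0 < ε) :
    ∃ K : ℕ, ∀ k, K ≤ k → ∀ φ : C.A →+* C.A,
      (∀ m, ∀ x ∈ C.D m, ∃ y ∈ C.D m, φ y = x) → ∀ S : Finset (C.A →ₐ[Ω] Ω),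
      (∀ α ∈ S, ∀ w, α (φ w) = α w ^ q ^ k) → (S.card : ℝ) ≤ (1 + ε) * (q : ℝ) ^ k := by
  obtain ⟨ψ, hψ⟩ := hC
  obtain ⟨s₀, hs⟩ := C.card_points_le (p := p) ψ hψ ε hε
  have hp : p.Prime := Fact.out
  refine ⟨s₀, fun k hk φ hφ S hS => ?_⟩
  have hqk : q ^ k = (p ^ (a * k)) ^ 2 := by rw [hq]; ring
  have h1 := hs (a * k) (by
    calc s₀ ≤ k := hk
      _ ≤ a * k := Nat.le_mul_of_pos_left _ ha
      _ ≤ p ^ (a * k) := (Nat.lt_pow_self hp.one_lt).le) φ hφ S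
    (fun α hα w => by rw [hS α hα, hqk])
  calc (S.card : ℝ) ≤ _ := h1
    _ = (1 + ε) * (q : ℝ) ^ k := by
      congr 1
      exact_mod_cast hqk.symm

theorem card_pts_le (a : ℕ) (ha : 1 ≤ a) (hq : q = (p ^ a) ^ 2) (hC : C.Embeds)
    (ε : ℝ) (hε : 0 < ε) :
    ∃ K : ℕ, ∀ k, K ≤ k → ∀ S : Finset (C.A →ₐ[Ω] Ω),
      (∀ α ∈ S, C.IsPt k α) → (S.card : ℝ) ≤ (1 + ε) * (q : ℝ) ^ k := by
  obtain ⟨K, hK⟩ := C.card_twisted_le (p := p) a ha hq hC ε hε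
  exact ⟨K, fun k hk S hS => hK k hk (C.fr k) (C.fr_surj k) S hS⟩

/-- The lift of a point to `A[√h]`. -/
noncomputable def liftPt (h : C.A) (hfr : ∀ k, C.fr k h = h) (hh : NonSq h)
    (α : C.A →ₐ[Ω] Ω) (y : Ω) (hy : y ^ 2 = α h) : (C.sqrt h hfr hh).A →ₐ[Ω] Ω :=
  QuadraticAlgebra.sqrtLiftAlg α y hy

theorem sqrtLiftAlg_frExt (a : ℕ) (hq : q = (p ^ a) ^ 2) (h : C.A) (hfr : ∀ k, C.fr k h = h)
    {k : ℕ} (α : C.A →ₐ[Ω] Ω) (hα : C.IsPt k α) (y : Ω) (hy : y ^ 2 = α h)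
    (σ : ℤˣ) (hσ : y ^ q ^ k = (σ : ℤ) * y) (w : QuadraticAlgebra C.A h 0) :
    QuadraticAlgebra.sqrtLiftAlg α y hy (QuadraticAlgebra.frExt (C.fr k) (hfr k) σ w) =
      QuadraticAlgebra.sqrtLiftAlg α y hy w ^ q ^ k := by
  have hqk : q ^ k = p ^ (a * 2 * k) := by rw [hq]; ring
  rw [QuadraticAlgebra.sqrtLiftAlg_apply, QuadraticAlgebra.sqrtLiftAlg_apply,
    QuadraticAlgebra.frExt_apply, hqk, add_pow_char_pow, ← hqk, mul_pow, hσ, ← hα, ← hα,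
    map_mul, map_intCast]
  ring

theorem liftPt_isPt (a : ℕ) (hq : q = (p ^ a) ^ 2) (h : C.A) (hfr : ∀ k, C.fr k h = h)
    (hh : NonSq h) {k : ℕ} (α : C.A →ₐ[Ω] Ω) (hα : C.IsPt k α) (y : Ω) (hy : y ^ 2 = α h)
    (hσ : y ^ q ^ k = y) : (C.sqrt h hfr hh).IsPt k (C.liftPt h hfr hh α y hy) :=
  fun w => C.sqrtLiftAlg_frExt a hq h hfr α hα y hy 1 (by simpa using hσ) w

end FrobCurve

namespace FrobCurve

variable {Ω : Type u} [Field Ω] {q : ℕ} (C : FrobCurve Ω q)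

/-- The inclusion of a curve's ring in the ring of its double cover. -/
noncomputable def sqrtIncl (h : C.A) (hfr : ∀ k, C.fr k h = h) (hh : NonSq h) :
    C.A →ₐ[Ω] (C.sqrt h hfr hh).A :=
  QuadraticAlgebra.inclAlg Ω h

/-- The adjoined square root. -/
noncomputable def sqrtRoot (h : C.A) (hfr : ∀ k, C.fr k h = h) (hh : NonSq h) :
    (C.sqrt h hfr hh).A :=
  (QuadraticAlgebra.omega : QuadraticAlgebra C.A h 0)

section
variable (h : C.A) (hfr : ∀ k, C.fr k h = h) (hh : NonSq h)

theorem sqrtRoot_sq : C.sqrtRoot h hfr hh ^ 2 = C.sqrtIncl h hfr hh h :=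
  QuadraticAlgebra.omega_sq (R := Ω)

theorem fr_sqrtRoot (k : ℕ) :
    (C.sqrt h hfr hh).fr k (C.sqrtRoot h hfr hh) = C.sqrtRoot h hfr hh := by
  change QuadraticAlgebra.frExt (C.fr k) (hfr k) 1 QuadraticAlgebra.omega =
    QuadraticAlgebra.omega
  rw [QuadraticAlgebra.frExt_apply]
  ext <;> simp

theorem fr_sqrtIncl (k : ℕ) (w : C.A) :
    (C.sqrt h hfr hh).fr k (C.sqrtIncl h hfr hh w) = C.sqrtIncl h hfr hh (C.fr k w) := by
  change QuadraticAlgebra.frExt (C.fr k) (hfr k) 1 (QuadraticAlgebra.inclAlg Ω h w) =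
    QuadraticAlgebra.inclAlg Ω h (C.fr k w)
  rw [QuadraticAlgebra.frExt_apply, QuadraticAlgebra.inclAlg_apply]
  ext <;> simp [QuadraticAlgebra.inclAlg_apply]

theorem liftPt_incl (α : C.A →ₐ[Ω] Ω) (y : Ω) (hy : y ^ 2 = α h) (w : C.A) :
    C.liftPt h hfr hh α y hy (C.sqrtIncl h hfr hh w) = α w := by
  change α w + α 0 * y = _
  simp

theorem liftPt_root (α : C.A →ₐ[Ω] Ω) (y : Ω) (hy : y ^ 2 = α h) :
    C.liftPt h hfr hh α y hy (C.sqrtRoot h hfr hh) = y := by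
  change α 0 + α 1 * y = _
  simp

theorem sqrt_hom_ext {B : Type*} [CommRing B] [Algebra Ω B]
    (f g : (C.sqrt h hfr hh).A →ₐ[Ω] B)
    (h1 : ∀ w, f (C.sqrtIncl h hfr hh w) = g (C.sqrtIncl h hfr hh w))
    (h2 : f (C.sqrtRoot h hfr hh) = g (C.sqrtRoot h hfr hh)) : f = g := by
  ext w
  have : ∀ w : QuadraticAlgebra C.A h 0, w = QuadraticAlgebra.inclAlg Ω h w.re +
      QuadraticAlgebra.inclAlg Ω h w.im * QuadraticAlgebra.omega := by
    intro w
    ext <;> simp [QuadraticAlgebra.inclAlg_apply]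
  have h3 : w = C.sqrtIncl h hfr hh (QuadraticAlgebra.re (b := 0) w) +
      C.sqrtIncl h hfr hh (QuadraticAlgebra.im (a := h) (b := 0) w) * C.sqrtRoot h hfr hh := this w
  rw [h3, map_add, map_add, map_mul, map_mul, h1, h1, h2]

theorem sqrtIncl_isPt {k : ℕ} (β : (C.sqrt h hfr hh).A →ₐ[Ω] Ω)
    (hβ : (C.sqrt h hfr hh).IsPt k β) : C.IsPt k (β.comp (C.sqrtIncl h hfr hh)) := by
  intro w
  have := hβ (C.sqrtIncl h hfr hh w)
  rw [fr_sqrtIncl] at this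
  exact this

/-- A formal disc embedding lifts to the double cover away from the branch locus. -/
theorem exists_lift_embedding [IsAlgClosed Ω] (h2 : (2 : Ω) ≠ 0) (ψ : C.A →ₐ[Ω] PowerSeries Ω)
    (hψ : Function.Injective ψ) (hc : PowerSeries.constantCoeff (ψ h) ≠ 0) :
    ∃ ψ' : (C.sqrt h hfr hh).A →ₐ[Ω] PowerSeries Ω, Function.Injective ψ' ∧
      ∀ w, ψ' (C.sqrtIncl h hfr hh w) = ψ w := by
  obtain ⟨y₀, hy₀⟩ := IsAlgClosed.exists_pow_nat_eq (PowerSeries.constantCoeff (ψ h))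
    (n := 2) (by norm_num)
  obtain ⟨y, hy⟩ := exists_powerSeries_sq_eq h2 (ψ h) y₀
    (by rintro rfl; apply hc; rw [← hy₀]; simp) hy₀.symm
  refine ⟨(QuadraticAlgebra.sqrtLiftAlg ψ y hy : QuadraticAlgebra C.A h 0 →ₐ[Ω] _), ?_, ?_⟩
  · exact QuadraticAlgebra.sqrtLift_injective hh (ψ : C.A →+* PowerSeries Ω) hψ y hy
  · intro w
    change ψ w + ψ 0 * y = _
    simp

theorem manyPts_sqrt [IsAlgClosed Ω] {p : ℕ} [Fact p.Prime] [CharP Ω p] (h2 : (2 : Ω) ≠ 0)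
    (a : ℕ) (ha : 1 ≤ a) (hq : q = (p ^ a) ^ 2) (hC : C.ManyPts)
    (hE : (C.sqrt h hfr hh).Embeds) : (C.sqrt h hfr hh).ManyPts := by
  classical
  intro ε hε
  obtain ⟨K₁, hK₁⟩ := hC (ε / 3) (by positivity)
  obtain ⟨K₂, hK₂⟩ := (C.sqrt h hfr hh).card_twisted_le (p := p) a ha hq hE (ε / 3) (by positivity)
  refine ⟨max K₁ K₂, fun k hk => ?_⟩
  obtain ⟨S, hS, hScard⟩ := hK₁ k (le_trans (le_max_left _ _) hk)
  choose y hy using fun α : C.A →ₐ[Ω] Ω =>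
    IsAlgClosed.exists_pow_nat_eq (α h) (n := 2) (by norm_num)
  let sg : (C.A →ₐ[Ω] Ω) × Bool → Ω := fun t => if t.2 then y t.1 else -y t.1
  have hsg : ∀ t, sg t ^ 2 = t.1 h := by
    rintro ⟨α, b⟩
    cases b <;> simp [sg, hy]
  let L : (C.A →ₐ[Ω] Ω) × Bool → ((C.sqrt h hfr hh).A →ₐ[Ω] Ω) := fun t =>
    C.liftPt h hfr hh t.1 (sg t) (hsg t)
  let P : (C.A →ₐ[Ω] Ω) × Bool → Prop := fun t =>
    (y t.1 = 0 ∧ t.2 = true) ∨ (y t.1 ≠ 0 ∧ y t.1 ^ q ^ k = y t.1)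
  have hLinj : ∀ t t', L t = L t' → t.1 = t'.1 ∧ sg t = sg t' := by
    intro t t' he
    refine ⟨?_, ?_⟩
    · ext w
      rw [← C.liftPt_incl h hfr hh t.1 (sg t) (hsg t) w,
        ← C.liftPt_incl h hfr hh t'.1 (sg t') (hsg t') w]
      exact congrArg (fun f => f (C.sqrtIncl h hfr hh w)) he
    · rw [← C.liftPt_root h hfr hh t.1 (sg t) (hsg t),
        ← C.liftPt_root h hfr hh t'.1 (sg t') (hsg t')]
      exact congrArg (fun f => f (C.sqrtRoot h hfr hh)) he
  have hinj : ∀ t t', (P t ↔ P t') → L t = L t' → t = t' := by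
    rintro ⟨α, b⟩ ⟨α', b'⟩ hP he
    obtain ⟨h1, h3⟩ := hLinj _ _ he
    dsimp only at h1
    subst h1
    by_cases h0 : y α = 0
    · simp only [P, h0] at hP
      cases b <;> cases b' <;> simp_all
    · have hne : y α ≠ -y α := by
        intro hc
        have : 2 * y α = 0 := by linear_combination hc
        exact (mul_ne_zero h2 h0) this
      cases b <;> cases b'
      · rfl
      · simp only [sg] at h3
        simp at h3
        exact absurd h3.symm hne
      · simp only [sg] at h3
        simp at h3
        exact absurd h3 hne
      · rfl
  have hqodd : ∀ x : Ω, (-x) ^ q ^ k = -(x ^ q ^ k) := by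
    have hp : p.Prime := Fact.out
    have hp2 : p ≠ 2 := by
      rintro rfl
      exact h2 (by exact_mod_cast CharP.cast_eq_zero Ω 2)
    intro x
    apply Odd.neg_pow
    rw [hq]
    exact (((hp.odd_of_ne_two hp2).pow).pow).pow
  have hsgn : ∀ α ∈ S, y α ^ q ^ k = y α ∨ y α ^ q ^ k = -y α := by
    intro α hα
    rw [← sq_eq_sq_iff_eq_or_eq_neg, hy, ← pow_mul, mul_comm, pow_mul, hy, ← hS α hα, hfr]
  set U := S ×ˢ (Finset.univ : Finset Bool)
  set Tp := (U.filter P).image L with hTp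
  set Tm := (U.filter fun t => ¬ P t).image L with hTm
  have hcp : Tp.card = (U.filter P).card := Finset.card_image_of_injOn (by
    intro t ht t' ht' he
    have e1 := (Finset.mem_filter.1 ht).2
    have e2 := (Finset.mem_filter.1 ht').2
    exact hinj t t' (iff_of_true e1 e2) he)
  have hcm : Tm.card = (U.filter fun t => ¬ P t).card := Finset.card_image_of_injOn (by
    intro t ht t' ht' he
    have e1 := (Finset.mem_filter.1 ht).2
    have e2 := (Finset.mem_filter.1 ht').2
    exact hinj t t' (iff_of_false e1 e2) he)
  have hsum : Tp.card + Tm.card = S.card * 2 := by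
    rw [hcp, hcm, Finset.card_filter_add_card_filter_not, Finset.card_product]
    simp
  have hTppt : ∀ α ∈ Tp, (C.sqrt h hfr hh).IsPt k α := by
    intro β hβ
    obtain ⟨t, ht, rfl⟩ := Finset.mem_image.1 hβ
    obtain ⟨htU, htP⟩ := Finset.mem_filter.1 ht
    have hα : t.1 ∈ S := (Finset.mem_product.1 htU).1
    refine C.liftPt_isPt (p := p) a hq h hfr hh t.1 (hS _ hα) (sg t) (hsg t) ?_
    obtain ⟨α, b⟩ := t
    have hqk : q ^ k ≠ 0 := by
      rw [hq]; have : p.Prime := Fact.out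
      exact pow_ne_zero _ (pow_ne_zero _ (pow_ne_zero _ this.ne_zero))
    rcases htP with ⟨h0, hb⟩ | ⟨_, h0⟩
    · dsimp only at h0
      simp only [sg, h0]
      cases b <;> simp [zero_pow hqk]
    · dsimp only at h0
      cases b
      · simp [sg, hqodd, h0]
      · simp [sg, h0]
  have hTmpt : ∀ β ∈ Tm, ∀ w : (C.sqrt h hfr hh).A,
      β (QuadraticAlgebra.frExt (C.fr k) (hfr k) (-1) w) = β w ^ q ^ k := by
    intro β hβ w
    obtain ⟨t, ht, rfl⟩ := Finset.mem_image.1 hβ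
    obtain ⟨htU, htP⟩ := Finset.mem_filter.1 ht
    have hα : t.1 ∈ S := (Finset.mem_product.1 htU).1
    refine C.sqrtLiftAlg_frExt (p := p) a hq h hfr t.1 (hS _ hα) (sg t) (hsg t) (-1) ?_ w
    obtain ⟨α, b⟩ := t
    have hqk : q ^ k ≠ 0 := by
      rw [hq]; have : p.Prime := Fact.out
      exact pow_ne_zero _ (pow_ne_zero _ (pow_ne_zero _ this.ne_zero))
    simp only [P, not_or, not_and] at htP
    have h4 : y α ^ q ^ k = - y α := by
      by_cases h0 : y α = 0
      · simp [h0, zero_pow hqk]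
      · exact (hsgn α hα).resolve_left (htP.2 h0)
    cases b
    · simp [sg, hqodd, h4]
    · simp [sg, h4]
  have hTmle := hK₂ k (le_trans (le_max_right _ _) hk)
    (QuadraticAlgebra.frExt (C.fr k) (hfr k) (-1))
    (fun m x hx => C.frExt_surj h (C.fr k) (hfr k) (C.fr_surj k) (-1) m x hx) Tm hTmpt
  refine ⟨Tp, hTppt, ?_⟩
  have hsumR : (Tp.card : ℝ) + Tm.card = S.card * 2 := by exact_mod_cast hsum
  linarith

end
end FrobCurve

section RationalPoints
variable (Ω : Type u) [Field Ω]

/-- The fixed points of the `Q`-power map. -/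
noncomputable def fixedPow (Q : ℕ) : Finset Ω :=
  open Classical in (Polynomial.X ^ Q - Polynomial.X : Polynomial Ω).roots.toFinset

variable {Ω}

theorem mem_fixedPow {Q : ℕ} (hQ : 1 < Q) {x : Ω} : x ∈ fixedPow Ω Q ↔ x ^ Q = x := by
  classical
  have : (Polynomial.X ^ Q - Polynomial.X : Polynomial Ω) ≠ 0 :=
    FiniteField.X_pow_card_sub_X_ne_zero Ω hQ
  rw [fixedPow, Multiset.mem_toFinset, mem_roots this]
  simp [sub_eq_zero]

theorem card_fixedPow [IsAlgClosed Ω] {p : ℕ} [CharP Ω p] {Q : ℕ} (hQ : 1 < Q) (hp : p ∣ Q) :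
    (fixedPow Ω Q).card = Q := by
  classical
  have hsep := galois_poly_separable (K := Ω) p Q hp
  rw [fixedPow, Multiset.toFinset_card_of_nodup (by convert nodup_roots hsep),
    ← (IsAlgClosed.splits (Polynomial.X ^ Q - Polynomial.X : Polynomial Ω)).natDegree_eq_card_roots,
    FiniteField.X_pow_card_sub_X_natDegree_eq Ω hQ]

end RationalPoints

namespace FrobCurve

variable {Ω : Type u} [Field Ω] [IsAlgClosed Ω] (p : ℕ) [Fact p.Prime] [CharP Ω p]

/-- The affine line. -/
noncomputable def line (a q : ℕ) (hq : q = (p ^ a) ^ 2) : FrobCurve Ω q where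
  A := Polynomial Ω
  z := Polynomial.X
  D := degreeLT Ω
  d := 1
  e := 0
  d_pos := Nat.one_pos
  D_mono := fun _ _ h => degreeLT_mono h
  D_fin := fun n => Module.Finite.equiv (degreeLTEquiv Ω n).symm
  D_rank := fun n => by
    rw [(degreeLTEquiv Ω n).finrank_eq]; simp
  D_exh := fun x => ⟨x.natDegree + 1, by
    rw [mem_degreeLT]
    exact degree_le_natDegree.trans_lt (by exact_mod_cast Nat.lt_succ_self _)⟩
  D_mul := fun m n x y hx hy => by
    rw [mem_degreeLT] at *
    by_cases h : x * y = 0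
    · rw [h, degree_zero]; exact WithBot.bot_lt_coe _
    · have hx0 := left_ne_zero_of_mul h
      have hy0 := right_ne_zero_of_mul h
      rw [degree_eq_natDegree h, natDegree_mul hx0 hy0]
      rw [degree_eq_natDegree hx0] at hx
      rw [degree_eq_natDegree hy0] at hy
      norm_cast at hx hy ⊢
      omega
  fr := fun k => mapRingHom (iterateFrobenius Ω p (a * 2 * k))
  fr_alg := fun k b => by
    have hqk : q ^ k = p ^ (a * 2 * k) := by rw [hq]; ring
    simp [hqk, iterateFrobenius_def]
  fr_z := fun k => by simp
  fr_surj := fun k n x hx => by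
    refine ⟨x.map ((iterateFrobeniusEquiv Ω p (a * 2 * k)).symm : Ω →+* Ω), ?_, ?_⟩
    · rw [mem_degreeLT] at *
      exact lt_of_le_of_lt (degree_map_le ..) hx
    · rw [coe_mapRingHom, Polynomial.map_map]
      convert Polynomial.map_id
      ext y
      exact (iterateFrobeniusEquiv Ω p (a * 2 * k)).apply_symm_apply y

variable (a q : ℕ) (hq : q = (p ^ a) ^ 2)

theorem line_exists_embedding (z₀ : Ω) : ∃ ψ : (line (Ω := Ω) p a q hq).A →ₐ[Ω] PowerSeries Ω,
    Function.Injective ψ ∧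
      ψ (line (Ω := Ω) p a q hq).z = PowerSeries.C z₀ + PowerSeries.X := by
  refine ⟨((Polynomial.coeToPowerSeries.algHom Ω).comp (taylorAlgHom z₀) :
    Polynomial Ω →ₐ[Ω] PowerSeries Ω), ?_, ?_⟩
  · intro f g hfg
    apply taylor_injective z₀
    have : (Polynomial.coeToPowerSeries.algHom Ω) (taylor z₀ f) =
      (Polynomial.coeToPowerSeries.algHom Ω) (taylor z₀ g) := hfg
    simpa [Polynomial.coeToPowerSeries.algHom_apply] using this
  · change (Polynomial.coeToPowerSeries.algHom Ω) (taylor z₀ Polynomial.X) = _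
    rw [taylor_X]
    simp [Polynomial.coeToPowerSeries.algHom_apply, add_comm]

/-- The point of the line with a given rational coordinate. -/
theorem line_exists_pt {k : ℕ} {x : Ω} (hx : x ^ q ^ k = x) :
    ∃ α : (line (Ω := Ω) p a q hq).A →ₐ[Ω] Ω, (line (Ω := Ω) p a q hq).IsPt k α ∧
      α (line (Ω := Ω) p a q hq).z = x := by
  refine ⟨(aeval x : Polynomial Ω →ₐ[Ω] Ω), ?_, ?_⟩
  · intro (w : Polynomial Ω)
    have hqk : q ^ k = p ^ (a * 2 * k) := by rw [hq]; ring
    change aeval x (w.map (iterateFrobenius Ω p (a * 2 * k))) = (aeval x w) ^ q ^ k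
    change eval x (w.map _) = (eval x w) ^ q ^ k
    rw [hqk, ← iterateFrobenius_def]
    conv_lhs => rw [← hx, hqk, ← iterateFrobenius_def]
    rw [eval_map, eval₂_hom]
  · exact aeval_X x

theorem line_pt_ext {α β : (line (Ω := Ω) p a q hq).A →ₐ[Ω] Ω}
    (h : α (line (Ω := Ω) p a q hq).z = β (line (Ω := Ω) p a q hq).z) : α = β :=
  Polynomial.algHom_ext (B := Ω) (R := Ω) h

variable {q} in
theorem one_lt_pow_of_eq_sq (ha : 1 ≤ a) (hq : q = (p ^ a) ^ 2) {k : ℕ} (hk : 1 ≤ k) :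
    1 < q ^ k ∧ p ∣ q ^ k := by
  have hp : p.Prime := Fact.out
  have hqk : q ^ k = p ^ (a * 2 * k) := by rw [hq]; ring
  have h0 : a * 2 * k ≠ 0 := by positivity
  rw [hqk]
  exact ⟨Nat.one_lt_pow h0 hp.one_lt, dvd_pow_self _ h0⟩

theorem line_manyPts (ha : 1 ≤ a) : (line (Ω := Ω) p a q hq).ManyPts := by
  classical
  intro ε hε
  refine ⟨1, fun k hk => ?_⟩
  obtain ⟨h1, h2⟩ := one_lt_pow_of_eq_sq p a ha hq hk
  have hx : ∀ x : fixedPow Ω (q ^ k), ∃ α : (line (Ω := Ω) p a q hq).A →ₐ[Ω] Ω,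
      (line (Ω := Ω) p a q hq).IsPt k α ∧ α (line (Ω := Ω) p a q hq).z = x :=
    fun x => line_exists_pt p a q hq ((mem_fixedPow h1).1 x.2)
  choose α hα hαz using hx
  refine ⟨Finset.univ.image α, ?_, ?_⟩
  · intro β hβ
    obtain ⟨x, -, rfl⟩ := Finset.mem_image.1 hβ
    exact hα x
  · rw [Finset.card_image_of_injective, Finset.card_univ, Fintype.card_coe,
      card_fixedPow (p := p) h1 h2]
    · push_cast
      have : (0 : ℝ) ≤ (q : ℝ) ^ k := by positivity
      nlinarith
    · intro x y hxy
      apply Subtype.ext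
      rw [← hαz x, ← hαz y, hxy]

end FrobCurve

section QuadraticMap

/-- The quadratic map `x ↦ x ^ 2 + c` on an algebra. -/
def qmap {R A : Type*} [CommRing R] [CommRing A] [Algebra R A] (c : R) (x : A) : A :=
  x ^ 2 + algebraMap R A c

variable {R A B : Type*} [CommRing R] [CommRing A] [Algebra R A] [CommRing B] [Algebra R B]

theorem map_qmap_iterate (c : R) (α : A →ₐ[R] B) (n : ℕ) (x : A) :
    α ((qmap c)^[n] x) = (qmap c)^[n] (α x) := by
  induction n generalizing x with
  | zero => rfl
  | succ n ih => rw [Function.iterate_succ_apply, Function.iterate_succ_apply, ih]; simp [qmap]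

theorem qmap_neg (c : R) (x : A) : qmap c (-x) = qmap c x := by simp [qmap]

theorem qmap_iterate_neg (c : R) (x : A) {n : ℕ} (hn : 1 ≤ n) :
    (qmap c)^[n] (-x) = (qmap c)^[n] x := by
  obtain ⟨m, rfl⟩ := Nat.exists_eq_add_of_le' hn
  rw [Function.iterate_succ_apply, Function.iterate_succ_apply, qmap_neg]

end QuadraticMap

section Dynamics

variable {Ω : Type u} [Field Ω]

/-- The forward orbit of the critical value of `x ^ 2 + c`. -/
def critOrbit (c : Ω) : Set Ω := {x | ∃ a, 1 ≤ a ∧ x = (qmap c)^[a] (0 : Ω)}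

theorem qmap_self_apply (c x : Ω) : qmap c x = x ^ 2 + c := rfl

theorem qmap_iterate_mem_critOrbit {c x : Ω} (hx : x ∈ critOrbit c) (n : ℕ) :
    (qmap c)^[n] x ∈ critOrbit c := by
  obtain ⟨a, ha, rfl⟩ := hx
  exact ⟨n + a, by omega, by rw [Function.iterate_add_apply]⟩

theorem qmap_surjective [IsAlgClosed Ω] (c : Ω) : Function.Surjective (qmap c : Ω → Ω) := by
  intro w
  obtain ⟨z, hz⟩ := IsAlgClosed.exists_pow_nat_eq (w - c) (n := 2) (by norm_num)
  exact ⟨z, by rw [qmap_self_apply, hz]; ring⟩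

/-- `τ` is reached in `r` steps from outside the critical orbit, avoiding `0`. -/
def Reach (c : Ω) (r : ℕ) (τ : Ω) : Prop :=
  ∃ w, (qmap c)^[r] w = τ ∧ w ∉ critOrbit c ∧ ∀ b < r, (qmap c)^[b] w ≠ 0

/-- Standing assumptions on the parameter `c`. -/
structure GoodParam (c : Ω) : Prop where
  two_ne : (2 : Ω) ≠ 0
  finite : (critOrbit c).Finite
  ne_zero : ∀ a, 1 ≤ a → (qmap c)^[a] (0 : Ω) ≠ 0
  ne_neg_two : c ≠ -2

namespace GoodParam

variable {c : Ω} (H : GoodParam c)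
include H

theorem c_ne_zero : c ≠ 0 := by
  have := H.ne_zero 1 le_rfl
  simpa [qmap] using this

theorem reach_of_neg_not_mem {e : ℕ} (he : 1 ≤ e) (hn : -((qmap c)^[e] (0 : Ω)) ∉ critOrbit c)
    {b : ℕ} (hb : e < b) : Reach c (b - e) ((qmap c)^[b] (0 : Ω)) := by
  refine ⟨_, ?_, hn, ?_⟩
  · rw [qmap_iterate_neg _ _ (by omega), ← Function.iterate_add_apply]
    congr 2
    omega
  · intro i _
    rcases Nat.eq_zero_or_pos i with rfl | hi
    · simpa using H.ne_zero e he
    · rw [qmap_iterate_neg _ _ hi, ← Function.iterate_add_apply]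
      exact H.ne_zero _ (by omega)

theorem second_ne_neg : (qmap c)^[2] (0 : Ω) ≠ -c := by
  intro h
  have : c * (c + 2) = 0 := by
    have : c ^ 2 + c = -c := by simpa [qmap] using h
    linear_combination this
  rcases mul_eq_zero.1 this with h1 | h1
  · exact H.c_ne_zero h1
  · exact H.ne_neg_two (by linear_combination h1)

theorem reach_crit (hc : -c ∈ critOrbit c) {b : ℕ} (hb : 2 ≤ b) :
    ∃ r, Reach c r ((qmap c)^[b] (0 : Ω)) := by
  obtain ⟨l, hl1, hl⟩ := hc
  have hl2 : 2 ≤ l := by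
    by_contra hlt
    have : l = 1 := by omega
    subst this
    have : -c = c := by simpa [qmap] using hl
    have : 2 * c = 0 := by linear_combination -this
    exact mul_ne_zero H.two_ne H.c_ne_zero this
  obtain ⟨T, rfl⟩ := Nat.exists_eq_add_of_le' (show 1 ≤ l by omega)
  have h1 : (qmap c)^[1] (0 : Ω) = c := by simp [qmap]
  have hper : ∀ n, 2 ≤ n → (qmap c)^[n + T] (0 : Ω) = (qmap c)^[n] (0 : Ω) := by
    intro n hn
    have e1 : n + T = (n - 1) + (T + 1) := by omega
    have e2 : n = (n - 1) + 1 := by omega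
    rw [e1, Function.iterate_add_apply, ← hl, qmap_iterate_neg _ _ (by omega)]
    conv_rhs => rw [e2, Function.iterate_add_apply, h1]
  have hn2 : -((qmap c)^[2] (0 : Ω)) ∉ critOrbit c := by
    rintro ⟨b, hb1, hb⟩
    rcases Nat.lt_or_ge b 2 with hb2 | hb2
    · have : b = 1 := by omega
      subst this
      rw [h1] at hb
      exact H.second_ne_neg (by linear_combination -hb)
    · have : (qmap c)^[2] (0 : Ω) = (qmap c)^[b] (0 : Ω) := by
        rw [← hper 2 le_rfl, ← hper b hb2, add_comm, add_comm b T, Function.iterate_add_apply,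
          Function.iterate_add_apply (qmap c) T b, ← hb, qmap_iterate_neg _ _ (by omega)]
      rw [← this] at hb
      have h3 : 2 * (qmap c)^[2] (0 : Ω) = 0 := by linear_combination -hb
      exact mul_ne_zero H.two_ne (H.ne_zero 2 (by norm_num)) h3
  rw [← hper b hb]
  exact ⟨_, H.reach_of_neg_not_mem (by norm_num) hn2 (by omega)⟩

theorem reach_neg {a : ℕ} (ha : -((qmap c)^[a] (0 : Ω)) ≠ c) :
    ∃ r, Reach c r (-((qmap c)^[a] (0 : Ω))) := by
  by_cases h : -((qmap c)^[a] (0 : Ω)) ∈ critOrbit c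
  · obtain ⟨b, hb1, hb⟩ := h
    have h1 : (qmap c)^[1] (0 : Ω) = c := by simp [qmap]
    have hb2 : 1 < b := by
      rcases Nat.lt_or_ge 1 b with h2 | h2
      · exact h2
      · have : b = 1 := by omega
        subst this
        exact absurd (hb.trans h1) ha
    rw [hb]
    by_cases hc : -c ∈ critOrbit c
    · exact H.reach_crit hc hb2
    · exact ⟨_, H.reach_of_neg_not_mem le_rfl (by rwa [h1]) hb2⟩
  · exact ⟨0, _, rfl, h, fun _ hb => absurd hb (Nat.not_lt_zero _)⟩

theorem exists_reach_bound : ∃ G : ℕ,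
    (∀ a, 1 ≤ a → -((qmap c)^[a] (0 : Ω)) ≠ c → ∃ r ≤ G, Reach c r (-((qmap c)^[a] (0 : Ω)))) ∧
    (-c ∈ critOrbit c → ∀ b, 2 ≤ b → ∃ r ≤ G, Reach c r ((qmap c)^[b] (0 : Ω))) := by
  classical
  let m : Ω → ℕ := fun τ => if h : ∃ r, Reach c r τ then h.choose else 0
  have hm : ∀ τ, (∃ r, Reach c r τ) → Reach c (m τ) τ := by
    intro τ h
    simp only [m, dif_pos h]
    exact h.choose_spec
  obtain ⟨G₁, hG₁⟩ := (H.finite.image m).bddAbove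
  obtain ⟨G₂, hG₂⟩ := (H.finite.image (fun x => m (-x))).bddAbove
  refine ⟨max G₁ G₂, ?_, ?_⟩
  · intro a ha hac
    exact ⟨_, le_trans (hG₂ ⟨_, ⟨a, ha, rfl⟩, rfl⟩) (le_max_right _ _), hm _ (H.reach_neg hac)⟩
  · intro hc b hb
    exact ⟨_, le_trans (hG₁ ⟨_, ⟨b, by omega, rfl⟩, rfl⟩) (le_max_left _ _),
      hm _ (H.reach_crit hc hb)⟩

end GoodParam
end Dynamics

section NonSquares

theorem NonSq.ne_zero {A : Type*} [CommRing A] [Nontrivial A] {h : A} (hh : NonSq h) : h ≠ 0 := by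
  rintro rfl
  exact one_ne_zero (hh 0 1 (by simp))

theorem NonSq.sq_mul {A : Type*} [CommRing A] [IsDomain A] {h s : A} (hs : s ≠ 0)
    (hh : NonSq h) : NonSq (s ^ 2 * h) := fun x y hxy =>
  (mul_eq_zero.1 (hh x (s * y) (by rw [hxy]; ring))).resolve_left hs

theorem NonSq.neg {Ω A : Type*} [Field Ω] [IsAlgClosed Ω] [CommRing A] [IsDomain A] [Algebra Ω A]
    {h : A} (hh : NonSq h) : NonSq (-h) := by
  obtain ⟨i, hi⟩ := IsAlgClosed.exists_pow_nat_eq (-1 : Ω) (n := 2) (by norm_num)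
  have h1 : (algebraMap Ω A i) ^ 2 = -1 := by rw [← map_pow, hi]; simp
  have h2 : algebraMap Ω A i ≠ 0 := by
    intro h0
    rw [h0] at h1
    simp at h1
  have := hh.sq_mul h2
  rwa [h1, neg_one_mul] at this

namespace QuadraticAlgebra

variable {A : Type*} [CommRing A] [IsDomain A] {h : A}

theorem eq_zero_of_norm_eq_zero (hh : NonSq h) (w : QuadraticAlgebra A h 0) (hw : w.norm = 0) :
    w = 0 := by
  rw [norm_def] at hw
  have h1 : w.im = 0 := hh w.re w.im (by linear_combination hw)
  rw [h1] at hw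
  have h2 : w.re = 0 := by
    have : w.re * w.re = 0 := by linear_combination hw
    simpa using this
  ext <;> simp [h1, h2]

theorem nonSq_sub_omega (hh : NonSq h) (C : A) (hC : NonSq (C ^ 2 - h)) :
    NonSq (algebraMap A (QuadraticAlgebra A h 0) C - omega) := by
  intro x y hxy
  refine eq_zero_of_norm_eq_zero hh y (hC x.norm y.norm ?_)
  have := congrArg norm hxy
  rw [map_pow, map_mul, map_pow] at this
  rw [this]
  congr 1
  rw [norm_def]
  simp
  ring

theorem nonSq_sub_omega_of_eq (h2 : (2 : A) ≠ 0) (hh : NonSq h) (C y s : A) (hs : s ^ 2 = 2)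
    (hy : h = C ^ 2 - y ^ 2) (h1 : NonSq (C + y)) (h3 : NonSq (C - y)) :
    NonSq (algebraMap A (QuadraticAlgebra A h 0) C - omega) := by
  have := isDomain_of_nonSq hh
  intro X Y hXY
  by_contra hY
  set ι := algebraMap A (QuadraticAlgebra A h 0)
  set V : QuadraticAlgebra A h 0 := (ι (C + y) - omega) * Y with hV
  set W : QuadraticAlgebra A h 0 := ι s * X with hW
  have hω : (omega : QuadraticAlgebra A h 0) ^ 2 = ι h := by
    rw [pow_two, omega_mul_omega_eq_mk]; rfl
  have hs' : ι s ^ 2 = 2 := by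
    rw [← map_pow, hs]
    exact map_ofNat ι 2
  have hy' : ι h = ι C ^ 2 - ι y ^ 2 := (congrArg ι hy).trans (by simp)
  have hVW : V ^ 2 = ι (C + y) * W ^ 2 := by
    rw [hV, hW, mul_pow, mul_pow, hXY, hs', map_add]
    linear_combination (Y ^ 2) * hω + Y ^ 2 * hy'
  have hV0 : V ≠ 0 := by
    refine mul_ne_zero ?_ hY
    intro h0
    have := congrArg im h0
    simp [ι] at this
  have hW0 : W ≠ 0 := by
    intro h0
    rw [h0] at hVW
    exact hV0 (by simpa using hVW)
  have hN0 : W.norm ≠ 0 := fun h0 => hW0 (eq_zero_of_norm_eq_zero hh W h0)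
  set U := V * star W with hU
  have hUsq : U ^ 2 = ι ((C + y) * W.norm ^ 2) := by
    rw [hU, mul_pow, hVW, map_mul, map_pow, algebraMap_norm_eq_mul_star]
    ring
  have hre : U.re ^ 2 + h * U.im ^ 2 = (C + y) * W.norm ^ 2 := by
    have := congrArg re hUsq
    rw [pow_two, re_mul] at this
    simp only [ι, algebraMap_re] at this
    linear_combination this
  have him : U.re * U.im = 0 := by
    have := congrArg im hUsq
    rw [pow_two, im_mul] at this
    simp only [ι, algebraMap_im] at this
    have : 2 * (U.re * U.im) = 0 := by linear_combination this
    exact (mul_eq_zero.1 this).resolve_left h2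
  rcases mul_eq_zero.1 him with h0 | h0
  · rw [h0] at hre
    have h4 : W.norm ^ 2 = (C - y) * U.im ^ 2 :=
      mul_left_cancel₀ h1.ne_zero (by linear_combination -hre + U.im ^ 2 * hy)
    rw [h3 _ _ h4] at h4
    exact hN0 (by simpa using h4)
  · rw [h0] at hre
    exact hN0 (h1 U.re _ (by rw [← hre]; ring))

end QuadraticAlgebra

theorem PowerSeries.nonSq_of_coeff {K : Type*} [Field K] (g : PowerSeries K)
    (h0 : PowerSeries.coeff 0 g = 0) (h1 : PowerSeries.coeff 1 g ≠ 0) : NonSq g := by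
  intro x y hxy
  by_contra hy
  have hg : g.order = (1 : ℕ) := by
    rw [PowerSeries.order_eq_nat]
    refine ⟨h1, fun i hi => ?_⟩
    have : i = 0 := by omega
    rw [this, h0]
  have hg0 : g ≠ 0 := by rintro rfl; simp at h1
  have hx : x ≠ 0 := by
    rintro rfl
    have : g * y ^ 2 ≠ 0 := mul_ne_zero hg0 (pow_ne_zero _ hy)
    exact this (by rw [← hxy]; simp)
  have ho := congrArg PowerSeries.order hxy
  rw [pow_two, pow_two, PowerSeries.order_mul, PowerSeries.order_mul, PowerSeries.order_mul, hg]
    at ho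
  obtain ⟨m, hm⟩ := ENat.ne_top_iff_exists.1 (PowerSeries.order_eq_top.not.2 hx)
  obtain ⟨n, hn⟩ := ENat.ne_top_iff_exists.1 (PowerSeries.order_eq_top.not.2 hy)
  rw [← hm, ← hn] at ho
  norm_cast at ho
  omega

theorem coeff_qmap_iterate {K : Type*} [Field K] (h2 : (2 : K) ≠ 0) (c z₀ : K) (j : ℕ)
    (hz : ∀ b < j, (qmap c)^[b] z₀ ≠ 0) :
    PowerSeries.constantCoeff ((qmap c)^[j] (PowerSeries.C z₀ + PowerSeries.X)) =
      (qmap c)^[j] z₀ ∧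
    PowerSeries.coeff 1 ((qmap c)^[j] (PowerSeries.C z₀ + PowerSeries.X)) ≠ 0 := by
  induction j with
  | zero => simp
  | succ j ih =>
    obtain ⟨e1, e2⟩ := ih fun b hb => hz b (by omega)
    rw [Function.iterate_succ_apply', Function.iterate_succ_apply']
    set g := (qmap c)^[j] (PowerSeries.C z₀ + PowerSeries.X) with hg
    refine ⟨?_, ?_⟩
    · simp [qmap, e1]
    · have : PowerSeries.coeff 1 (qmap c g) = 2 * (qmap c)^[j] z₀ * PowerSeries.coeff 1 g := by
        have e3 : PowerSeries.coeff 1 (algebraMap K (PowerSeries K) c) = 0 := by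
          change PowerSeries.coeff 1 (PowerSeries.C c) = 0
          rw [PowerSeries.coeff_C, if_neg one_ne_zero]
        rw [qmap, map_add, e3, pow_two, PowerSeries.coeff_mul, ← e1,
          Finset.Nat.sum_antidiagonal_succ]
        simp
        ring
      rw [this]
      exact mul_ne_zero (mul_ne_zero h2 (hz j (by omega))) e2

end NonSquares

namespace FrobCurve

variable {Ω : Type u} [Field Ω] [IsAlgClosed Ω] {q : ℕ} (C : FrobCurve Ω q)

/-- Formal disc embeddings exist over all `z₀` whose `n`-th iterate avoids the critical orbit. -/
def EmbedsAway (c : Ω) (n : ℕ) : Prop := ∀ z₀ : Ω, (qmap c)^[n] z₀ ∉ critOrbit c →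
  ∃ ψ : C.A →ₐ[Ω] PowerSeries Ω, Function.Injective ψ ∧
    ψ C.z = PowerSeries.C z₀ + PowerSeries.X

variable {C} {c : Ω}

omit [IsAlgClosed Ω] in
theorem EmbedsAway.mono {m n : ℕ} (h : C.EmbedsAway c m) (hmn : m ≤ n) : C.EmbedsAway c n := by
  intro z₀ hz
  refine h z₀ fun hm => hz ?_
  have := qmap_iterate_mem_critOrbit hm (n - m)
  rwa [← Function.iterate_add_apply, Nat.sub_add_cancel hmn] at this

theorem EmbedsAway.nonSq (h2 : (2 : Ω) ≠ 0) {n r j : ℕ} {τ : Ω} (h : C.EmbedsAway c n)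
    (hr : Reach c r τ) (hj : n + r ≤ j) :
    NonSq ((qmap c)^[j] C.z - algebraMap Ω C.A τ) := by
  obtain ⟨w, hw, hwn, hwb⟩ := hr
  obtain ⟨z₀, hz₀⟩ := (qmap_surjective c).iterate (j - r) w
  have hmem : ∀ m, m ≤ j - r → (qmap c)^[m] z₀ ∉ critOrbit c := by
    intro m hm hc
    have := qmap_iterate_mem_critOrbit hc (j - r - m)
    rw [← Function.iterate_add_apply, Nat.sub_add_cancel hm, hz₀] at this
    exact hwn this
  obtain ⟨ψ, hψ, hψz⟩ := h z₀ (hmem n (by omega))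
  have hj0 : (qmap c)^[j] z₀ = τ := by
    rw [← hw, ← hz₀, ← Function.iterate_add_apply]
    congr 2
    omega
  have hne : ∀ b < j, (qmap c)^[b] z₀ ≠ 0 := by
    intro b hb h0
    rcases Nat.lt_or_ge b (j - r) with hlt | hge
    · refine hmem (j - r) le_rfl ⟨j - r - b, by omega, ?_⟩
      rw [← h0, ← Function.iterate_add_apply]
      congr 2
      omega
    · refine hwb (b - (j - r)) (by omega) ?_
      rw [← hz₀, ← Function.iterate_add_apply, ← h0]
      congr 2
      omega
  obtain ⟨e1, e2⟩ := coeff_qmap_iterate h2 c z₀ j hne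
  have hψv : ψ ((qmap c)^[j] C.z - algebraMap Ω C.A τ) =
      (qmap c)^[j] (PowerSeries.C z₀ + PowerSeries.X) - PowerSeries.C τ := by
    rw [map_sub, map_qmap_iterate, hψz, AlgHom.commutes]
    rfl
  have hps : NonSq (ψ ((qmap c)^[j] C.z - algebraMap Ω C.A τ)) := by
    rw [hψv]
    apply PowerSeries.nonSq_of_coeff
    · rw [map_sub, PowerSeries.coeff_zero_eq_constantCoeff_apply, e1, hj0]; simp
    · rw [map_sub, PowerSeries.coeff_C]
      simpa using e2
  intro x y hxy
  apply hψ
  rw [map_zero]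
  refine hps (ψ x) (ψ y) ?_
  rw [← map_pow, hxy, map_mul, map_pow]

end FrobCurve

theorem constantCoeff_qmap_iterate {K : Type*} [Field K] (c : K) (n : ℕ) (g : PowerSeries K) :
    PowerSeries.constantCoeff ((qmap c)^[n] g) = (qmap c)^[n] (PowerSeries.constantCoeff g) := by
  induction n with
  | zero => rfl
  | succ n ih =>
    rw [Function.iterate_succ_apply', Function.iterate_succ_apply', ← ih]
    simp [qmap]

theorem qmap_iterate_self {Ω : Type*} [Field Ω] (c : Ω) (n : ℕ) :
    (qmap c)^[n] c = (qmap c)^[n + 1] (0 : Ω) := by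
  rw [Function.iterate_succ_apply]
  congr 1
  simp [qmap]

namespace FrobCurve

variable {Ω : Type u} [Field Ω] {q : ℕ}

/-- `C'` is obtained from `C` by adjoining `v` with `f^[i] v = u`, where `f x = x ^ 2 + c`. -/
structure IterPreimage (c : Ω) (C : FrobCurve Ω q) (u : C.A) (i : ℕ) (C' : FrobCurve Ω q) where
  incl : C.A →ₐ[Ω] C'.A
  v : C'.A
  iter : (qmap c)^[i] v = incl u
  map_z : incl C.z = C'.z
  fr_v : ∀ k, C'.fr k v = v
  isPt : ∀ k β, C'.IsPt k β → C.IsPt k (β.comp incl)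
  exists_pt : ∀ k β, C.IsPt k β → ∀ x : Ω, x ^ q ^ k = x → (qmap c)^[i] x = β u →
    ∃ α, C'.IsPt k α ∧ (∀ w, α (incl w) = β w) ∧ α v = x
  hom_ext : ∀ f g : C'.A →ₐ[Ω] Ω, (∀ w, f (incl w) = g (incl w)) → f v = g v → f = g
  embed : ∀ ψ : C.A →ₐ[Ω] PowerSeries Ω, Function.Injective ψ →
    PowerSeries.constantCoeff (ψ u) ∉ critOrbit c →
    ∃ ψ' : C'.A →ₐ[Ω] PowerSeries Ω, Function.Injective ψ' ∧ ∀ w, ψ' (incl w) = ψ w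
  manyPts : (∃ ψ : C.A →ₐ[Ω] PowerSeries Ω, Function.Injective ψ ∧
    PowerSeries.constantCoeff (ψ u) ∉ critOrbit c) → C.ManyPts → C'.ManyPts

namespace IterPreimage

variable {c : Ω} {C C' : FrobCurve Ω q} {u : C.A} {i : ℕ}

/-- The trivial tower. -/
def refl (c : Ω) (C : FrobCurve Ω q) (u : C.A) (hu : ∀ k, C.fr k u = u) :
    IterPreimage c C u 0 C where
  incl := AlgHom.id Ω C.A
  v := u
  iter := rfl
  map_z := rfl
  fr_v := hu
  isPt := fun _ _ hβ => hβ
  exists_pt := fun _ β hβ _ _ hx => ⟨β, hβ, fun _ => rfl, hx.symm⟩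
  hom_ext := fun _ _ h _ => AlgHom.ext h
  embed := fun ψ hψ _ => ⟨ψ, hψ, fun _ => rfl⟩
  manyPts := fun _ h => h

theorem fr_sub (S : IterPreimage c C u i C') (hc : ∀ k, c ^ q ^ k = c) (k : ℕ) :
    C'.fr k (S.v - algebraMap Ω C'.A c) = S.v - algebraMap Ω C'.A c := by
  rw [map_sub, S.fr_v, C'.fr_alg, hc]

variable [IsAlgClosed Ω] {p : ℕ} [Fact p.Prime] [CharP Ω p]

theorem exists_embed_succ (S : IterPreimage c C u i C') (h2 : (2 : Ω) ≠ 0)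
    (hc : ∀ k, c ^ q ^ k = c) (hns : NonSq (S.v - algebraMap Ω C'.A c))
    (ψ : C.A →ₐ[Ω] PowerSeries Ω) (hψ : Function.Injective ψ)
    (hu : PowerSeries.constantCoeff (ψ u) ∉ critOrbit c) :
    ∃ ψ' : (C'.sqrt _ (S.fr_sub hc) hns).A →ₐ[Ω] PowerSeries Ω, Function.Injective ψ' ∧
      ∀ w, ψ' (C'.sqrtIncl _ (S.fr_sub hc) hns (S.incl w)) = ψ w := by
  obtain ⟨ψ₁, hψ₁, h1⟩ := S.embed ψ hψ hu
  obtain ⟨ψ₂, hψ₂, h3⟩ := C'.exists_lift_embedding _ (S.fr_sub hc) hns h2 ψ₁ hψ₁ (by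
    intro h0
    apply hu
    refine ⟨i + 1, by omega, ?_⟩
    have h4 : PowerSeries.constantCoeff (ψ₁ S.v) = c := by
      rw [map_sub, AlgHom.commutes, map_sub] at h0
      have : PowerSeries.constantCoeff (algebraMap Ω (PowerSeries Ω) c) = c := by simp
      rw [this] at h0
      exact sub_eq_zero.1 h0
    rw [← h1, ← S.iter, map_qmap_iterate, constantCoeff_qmap_iterate, h4, qmap_iterate_self])
  exact ⟨ψ₂, hψ₂, fun w => by rw [h3, h1]⟩

/-- One more step in a tower of iterated preimages. -/
noncomputable def succ (S : IterPreimage c C u i C') (h2 : (2 : Ω) ≠ 0)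
    (a : ℕ) (ha : 1 ≤ a) (hq : q = (p ^ a) ^ 2)
    (hc : ∀ k, c ^ q ^ k = c) (hns : NonSq (S.v - algebraMap Ω C'.A c)) :
    IterPreimage c C u (i + 1) (C'.sqrt _ (S.fr_sub hc) hns) where
  incl := (C'.sqrtIncl _ (S.fr_sub hc) hns).comp S.incl
  v := C'.sqrtRoot _ (S.fr_sub hc) hns
  iter := by
    rw [Function.iterate_succ_apply, qmap, sqrtRoot_sq, map_sub, AlgHom.commutes, sub_add_cancel,
      ← map_qmap_iterate, S.iter]
    rfl
  map_z := by
    rw [AlgHom.comp_apply, S.map_z]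
    rfl
  fr_v := fr_sqrtRoot _ _ _ _
  isPt := fun k β hβ => S.isPt k _ (C'.sqrtIncl_isPt _ (S.fr_sub hc) hns β hβ)
  exists_pt := fun k β hβ x hx hxu => by
    have hqk : q ^ k = p ^ (a * 2 * k) := by rw [hq]; ring
    obtain ⟨α, hα, h1, h3⟩ := S.exists_pt k β hβ (qmap c x) (by
      rw [qmap_self_apply, hqk, add_pow_char_pow, ← hqk, hc, ← pow_mul, mul_comm, pow_mul, hx])
      (by rw [← hxu, Function.iterate_succ_apply])
    have hy : x ^ 2 = α (S.v - algebraMap Ω C'.A c) := by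
      rw [map_sub, h3, AlgHom.commutes, qmap_self_apply]
      simp
    refine ⟨C'.liftPt _ (S.fr_sub hc) hns α x hy,
      C'.liftPt_isPt (p := p) a hq _ (S.fr_sub hc) hns α hα x hy hx, fun w => ?_, ?_⟩
    · rw [AlgHom.comp_apply, liftPt_incl, h1]
    · rw [liftPt_root]
  hom_ext := fun f g h1 h3 => by
    refine C'.sqrt_hom_ext _ (S.fr_sub hc) hns f g (fun w => ?_) h3
    refine congrArg (fun t : C'.A →ₐ[Ω] Ω => t w)
      (S.hom_ext (f.comp (C'.sqrtIncl _ (S.fr_sub hc) hns))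
        (g.comp (C'.sqrtIncl _ (S.fr_sub hc) hns)) h1 ?_)
    have h4 : C'.sqrtIncl _ (S.fr_sub hc) hns S.v =
        C'.sqrtRoot _ (S.fr_sub hc) hns ^ 2 +
          algebraMap Ω (C'.sqrt _ (S.fr_sub hc) hns).A c := by
      rw [sqrtRoot_sq, map_sub, AlgHom.commutes, sub_add_cancel]
    rw [AlgHom.comp_apply, AlgHom.comp_apply, h4, map_add, map_add, map_pow, map_pow, h3,
      AlgHom.commutes, AlgHom.commutes]
  embed := S.exists_embed_succ h2 hc hns
  manyPts := by
    rintro ⟨ψ, hψ, hu⟩ hm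
    obtain ⟨ψ', hψ', -⟩ := S.exists_embed_succ h2 hc hns ψ hψ hu
    exact C'.manyPts_sqrt _ (S.fr_sub hc) hns h2 a ha hq (S.manyPts ⟨ψ, hψ, hu⟩ hm) ⟨ψ', hψ'⟩

end IterPreimage

/-- All translates `c_a - v` of an element along the critical orbit are nonsquares. -/
def CritNonSq (c : Ω) (C : FrobCurve Ω q) (v : C.A) : Prop :=
  ∀ a, 1 ≤ a → NonSq (algebraMap Ω C.A ((qmap c)^[a] (0 : Ω)) - v)

variable {c : Ω} {C : FrobCurve Ω q}

theorem critNonSq_sqrtRoot (v : C.A) (hfr : ∀ k, C.fr k (v - algebraMap Ω C.A c) =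
      v - algebraMap Ω C.A c) (hns : NonSq (v - algebraMap Ω C.A c)) (hv : CritNonSq c C v) :
    CritNonSq c (C.sqrt _ hfr hns) (C.sqrtRoot _ hfr hns) := by
  intro a ha
  refine QuadraticAlgebra.nonSq_sub_omega hns (algebraMap Ω C.A ((qmap c)^[a] (0 : Ω))) ?_
  have := hv (a + 1) (by omega)
  rw [Function.iterate_succ_apply', qmap_self_apply, map_add, map_pow] at this
  convert this using 1
  ring

variable [IsAlgClosed Ω] {p : ℕ} [Fact p.Prime] [CharP Ω p]

theorem exists_iterPreimage (u : C.A) (hu : ∀ k, C.fr k u = u) (h2 : (2 : Ω) ≠ 0)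
    (a : ℕ) (ha : 1 ≤ a) (hq : q = (p ^ a) ^ 2) (hc : ∀ k, c ^ q ^ k = c)
    (hns : NonSq (u - algebraMap Ω C.A c))
    (hroot : ∀ hfr, CritNonSq c (C.sqrt _ hfr hns) (C.sqrtRoot _ hfr hns)) (i : ℕ) :
    ∃ C', ∃ S : IterPreimage c C u (i + 1) C', CritNonSq c C' S.v := by
  induction i with
  | zero => exact ⟨_, (IterPreimage.refl c C u hu).succ h2 a ha hq hc hns, hroot _⟩
  | succ i ih =>
    obtain ⟨C', S, hS⟩ := ih
    have h1 : NonSq (S.v - algebraMap Ω C'.A c) := by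
      have := (hS 1 le_rfl).neg (Ω := Ω)
      rw [← qmap_iterate_self c 0, neg_sub] at this
      exact this
    exact ⟨_, S.succ h2 a ha hq hc h1, critNonSq_sqrtRoot _ _ _ hS⟩

omit [IsAlgClosed Ω] in
theorem fr_qmap_iterate (hc : ∀ k, c ^ q ^ k = c) (j k : ℕ) :
    C.fr k ((qmap c)^[j] C.z) = (qmap c)^[j] C.z := by
  induction j with
  | zero => exact C.fr_z k
  | succ j ih => rw [Function.iterate_succ_apply', qmap, map_add, map_pow, ih, C.fr_alg, hc]

/-- Adjoining an iterated preimage of `-f^[j] z`. -/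
theorem exists_iterPreimage_neg (H : GoodParam c) (a : ℕ) (ha : 1 ≤ a) (hq : q = (p ^ a) ^ 2)
    (hc : ∀ k, c ^ q ^ k = c) {G : ℕ}
    (hG₁ : ∀ a, 1 ≤ a → -((qmap c)^[a] (0 : Ω)) ≠ c → ∃ r ≤ G, Reach c r (-((qmap c)^[a] (0 : Ω))))
    (hG₂ : -c ∈ critOrbit c → ∀ b, 2 ≤ b → ∃ r ≤ G, Reach c r ((qmap c)^[b] (0 : Ω)))
    {n j : ℕ} (hC : C.EmbedsAway c n) (hj : n + G + 1 ≤ j) (i : ℕ) :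
    ∃ C', Nonempty (IterPreimage c C (-((qmap c)^[j] C.z)) (i + 1) C') := by
  have hA : ∀ j', n + G ≤ j' → ∀ b, 1 ≤ b → -((qmap c)^[b] (0 : Ω)) ≠ c →
      NonSq ((qmap c)^[j'] C.z + algebraMap Ω C.A ((qmap c)^[b] (0 : Ω))) := by
    intro j' hj' b hb hbc
    obtain ⟨r, hr, hR⟩ := hG₁ b hb hbc
    have := hC.nonSq H.two_ne hR (j := j') (by omega)
    rwa [map_neg, sub_neg_eq_add] at this
  have h1 : (qmap c)^[1] (0 : Ω) = c := (qmap_iterate_self c 0).symm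
  have hc2 : -c ≠ c := by
    intro h0
    exact mul_ne_zero H.two_ne H.c_ne_zero (by linear_combination -h0)
  have hns : NonSq (-((qmap c)^[j] C.z) - algebraMap Ω C.A c) := by
    have := (hA j (by omega) 1 le_rfl (by rwa [h1])).neg (Ω := Ω)
    rw [h1] at this
    convert this using 1
    ring
  obtain ⟨C', S, -⟩ := exists_iterPreimage (p := p) (c := c) (-((qmap c)^[j] C.z))
    (fun k => by rw [map_neg, fr_qmap_iterate hc]) H.two_ne a ha hq hc hns (by
    intro hfr b hb
    by_cases hbc : -((qmap c)^[b + 1] (0 : Ω)) = c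
    · have hbc' : (qmap c)^[b] (0 : Ω) ^ 2 = -(2 * c) := by
        rw [Function.iterate_succ_apply', qmap_self_apply] at hbc
        linear_combination -hbc
      have hb2 : 2 ≤ b := by
        by_contra hlt
        have : b = 1 := by omega
        subst this
        exact H.second_ne_neg (by linear_combination -hbc)
      obtain ⟨s, hs⟩ := IsAlgClosed.exists_pow_nat_eq (2 : Ω) (n := 2) (by norm_num)
      obtain ⟨j, rfl⟩ := Nat.exists_eq_add_of_le' (show 1 ≤ j by omega)
      have h2A : (2 : C.A) ≠ 0 := by
        intro h0
        apply H.two_ne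
        apply FaithfulSMul.algebraMap_injective Ω C.A
        rw [map_zero, ← h0]
        exact map_ofNat _ 2
      have hb3 : -((qmap c)^[b] (0 : Ω)) ≠ c := by
        intro h0
        apply H.second_ne_neg
        have e : (qmap c)^[b] (0 : Ω) = -c := by linear_combination -h0
        have e2 : (qmap c)^[2] (0 : Ω) = (qmap c)^[b + 1] 0 := by
          rw [Function.iterate_succ_apply', h1, Function.iterate_succ_apply', e, qmap_neg]
        rw [e2]
        linear_combination -hbc
      obtain ⟨r, hr, hR⟩ := hG₂ ⟨b + 1, by omega, by linear_combination hbc⟩ b hb2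
      refine QuadraticAlgebra.nonSq_sub_omega_of_eq h2A hns
        (algebraMap Ω C.A ((qmap c)^[b] (0 : Ω))) ((qmap c)^[j] C.z) (algebraMap Ω C.A s) ?_ ?_ ?_ ?_
      · rw [← map_pow, hs]
        exact map_ofNat _ 2
      · rw [← map_pow, hbc', Function.iterate_succ_apply', qmap, map_neg, map_mul, map_ofNat]
        ring
      · rw [add_comm]
        exact hA j (by omega) b hb hb3
      · have := (hC.nonSq H.two_ne hR (j := j) (by omega)).neg (Ω := Ω)
        rwa [neg_sub] at this
    · refine QuadraticAlgebra.nonSq_sub_omega hns (algebraMap Ω C.A ((qmap c)^[b] (0 : Ω))) ?_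
      have := hA j (by omega) (b + 1) (by omega) hbc
      rw [Function.iterate_succ_apply' _ b, qmap_self_apply, map_add, map_pow] at this
      convert this using 1
      ring) i
  exact ⟨C', ⟨S⟩⟩

omit [IsAlgClosed Ω] in
theorem IterPreimage.embedsAway {n j i : ℕ} {C' : FrobCurve Ω q} (hC : C.EmbedsAway c n)
    (hj : n ≤ j + 1) (S : IterPreimage c C (-((qmap c)^[j] C.z)) i C') :
    C'.EmbedsAway c (j + 1) := by
  intro z₀ hz
  obtain ⟨ψ, hψ, h1⟩ := hC.mono hj z₀ hz
  obtain ⟨ψ', hψ', h3⟩ := S.embed ψ hψ (by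
    intro h0
    apply hz
    rw [map_neg, map_neg, map_qmap_iterate, constantCoeff_qmap_iterate, h1] at h0
    have := qmap_iterate_mem_critOrbit h0 1
    rw [Function.iterate_one, qmap_neg, ← Function.iterate_succ_apply' (qmap c)] at this
    simpa using this)
  exact ⟨ψ', hψ', by rw [← S.map_z, h3, h1]⟩

theorem EmbedsAway.exists_embedding (hf : (critOrbit c).Finite) {n : ℕ}
    (hC : C.EmbedsAway c n) (m : ℕ) (hm : n ≤ m + 1) :
    ∃ ψ : C.A →ₐ[Ω] PowerSeries Ω, Function.Injective ψ ∧
      PowerSeries.constantCoeff (ψ (-((qmap c)^[m] C.z))) ∉ critOrbit c := by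
  obtain ⟨w, hw⟩ := hf.exists_notMem
  obtain ⟨z₀, hz₀⟩ := (qmap_surjective c).iterate (m + 1) w
  obtain ⟨ψ, hψ, h1⟩ := hC.mono hm z₀ (by rwa [hz₀])
  refine ⟨ψ, hψ, fun h0 => hw ?_⟩
  rw [map_neg, map_neg, map_qmap_iterate, constantCoeff_qmap_iterate, h1] at h0
  have := qmap_iterate_mem_critOrbit h0 1
  rw [Function.iterate_one, qmap_neg, ← Function.iterate_succ_apply' (qmap c)] at this
  rw [← hz₀]
  simpa using this

end FrobCurve

section PreimageCount
variable {Ω : Type u} [Field Ω]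

/-- The rational `v` with `f^[i] v = - f^[j] z`, where `f x = x ^ 2 + c`. -/
noncomputable def preFiber (c : Ω) (Q i j : ℕ) (z : Ω) : Finset Ω :=
  open Classical in (fixedPow Ω Q).filter fun v => (qmap c)^[i] v = -((qmap c)^[j] z)

theorem mem_preFiber {c : Ω} {Q i j : ℕ} {z v : Ω} : v ∈ preFiber c Q i j z ↔
    v ∈ fixedPow Ω Q ∧ (qmap c)^[i] v = -((qmap c)^[j] z) := by
  classical
  rw [preFiber, Finset.mem_filter]

open Classical in
theorem card_filter_iterate_le (c w : Ω) (R : Finset Ω) (hR : ∀ x ∈ R, qmap c x ∈ R) (i : ℕ) :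
    (R.filter fun v => (qmap c)^[i] v = w).card ≤ 2 ^ i := by
  induction i with
  | zero =>
    rw [pow_zero, Finset.card_le_one]
    intro a ha b hb
    exact (Finset.mem_filter.1 ha).2.trans (Finset.mem_filter.1 hb).2.symm
  | succ i ih =>
    have hsub : (R.filter fun v => (qmap c)^[i + 1] v = w) ⊆
        (R.filter fun v => (qmap c)^[i] v = w).biUnion
          fun y => R.filter fun v => qmap c v = y := by
      intro v hv
      obtain ⟨h1, h2⟩ := Finset.mem_filter.1 hv
      rw [Finset.mem_biUnion]
      refine ⟨qmap c v, Finset.mem_filter.2 ⟨hR v h1, ?_⟩, Finset.mem_filter.2 ⟨h1, rfl⟩⟩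
      rwa [Function.iterate_succ_apply] at h2
    refine (Finset.card_le_card hsub).trans ((Finset.card_biUnion_le_card_mul _ _ 2 ?_).trans ?_)
    · intro y _
      by_cases hne : ∃ x, qmap c x = y
      · obtain ⟨x, rfl⟩ := hne
        refine (Finset.card_le_card (t := {x, -x}) ?_).trans Finset.card_le_two
        intro v hv
        have h1 : v ^ 2 = x ^ 2 := by simpa [qmap_self_apply] using (Finset.mem_filter.1 hv).2
        simpa using sq_eq_sq_iff_eq_or_eq_neg.1 h1
      · rw [Finset.filter_false_of_mem fun v _ h => hne ⟨v, h⟩]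
        simp
    · rw [pow_succ]
      exact Nat.mul_le_mul_right 2 ih

theorem card_preFiber_le {c : Ω} {Q : ℕ} (hR : ∀ x ∈ fixedPow Ω Q, qmap c x ∈ fixedPow Ω Q)
    (i j : ℕ) (z : Ω) : (preFiber c Q i j z).card ≤ 2 ^ i := by
  classical
  convert card_filter_iterate_le c (-((qmap c)^[j] z)) (fixedPow Ω Q) hR i
  rw [preFiber]

end PreimageCount

namespace FrobCurve

variable {Ω : Type u} [Field Ω] {q : ℕ}

theorem IsPt.pow_eq {C : FrobCurve Ω q} {k : ℕ} {α : C.A →ₐ[Ω] Ω} (h : C.IsPt k α) {w : C.A}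
    (hw : C.fr k w = w) : α w ^ q ^ k = α w := by rw [← h, hw]

variable [IsAlgClosed Ω] {p : ℕ} [Fact p.Prime] [CharP Ω p]

theorem exists_moments {c : Ω} (H : GoodParam c) (a : ℕ) (ha : 1 ≤ a) (hq : q = (p ^ a) ^ 2)
    (hc : ∀ k, c ^ q ^ k = c) : ∃ g : ℕ, 1 ≤ g ∧ ∀ i ε, 1 ≤ i → (0 : ℝ) < ε →
      (∀ j, g ≤ j → ∃ K : ℕ, ∀ k, K ≤ k → (1 - ε) * (q : ℝ) ^ k ≤
        ∑ z ∈ fixedPow Ω (q ^ k), ((preFiber c (q ^ k) i j z).card : ℝ)) ∧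
      (∀ j j', g ≤ j → j + g ≤ j' → ∃ K : ℕ, ∀ k, K ≤ k →
        ∑ z ∈ fixedPow Ω (q ^ k), ((preFiber c (q ^ k) i j z).card : ℝ) *
          (preFiber c (q ^ k) i j' z).card ≤ (1 + ε) * (q : ℝ) ^ k) := by
  classical
  obtain ⟨G, hG₁, hG₂⟩ := H.exists_reach_bound
  refine ⟨G + 2, by omega, fun i ε hi hε => ?_⟩
  obtain ⟨i, rfl⟩ := Nat.exists_eq_add_of_le' hi
  set L : FrobCurve Ω q := line (Ω := Ω) p a q hq with hL
  have hLE : L.EmbedsAway c 0 := fun z₀ _ => line_exists_embedding p a q hq z₀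
  have hmem : ∀ {k : ℕ}, 1 ≤ k → ∀ {x : Ω}, x ∈ fixedPow Ω (q ^ k) ↔ x ^ q ^ k = x :=
    fun hk => mem_fixedPow (one_lt_pow_of_eq_sq p a ha hq hk).1
  refine ⟨fun j hj => ?_, fun j j' hj hj' => ?_⟩
  · obtain ⟨C, ⟨S⟩⟩ := exists_iterPreimage_neg (p := p) H a ha hq hc hG₁ hG₂ hLE
      (show 0 + G + 1 ≤ j by omega) i
    obtain ⟨K, hK⟩ := S.manyPts (hLE.exists_embedding H.finite j (by omega))
      (line_manyPts p a q hq ha) ε hε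
    refine ⟨max K 1, fun k hk => ?_⟩
    obtain ⟨T, hT, hTc⟩ := hK k (le_of_max_le_left hk)
    refine hTc.trans ?_
    rw [← Nat.cast_sum, ← Finset.card_sigma, Nat.cast_le]
    have hm := fun x => @hmem k (le_of_max_le_right hk) x
    refine Finset.card_le_card_of_injOn (fun α => ⟨α C.z, α S.v⟩) ?_ ?_
    · intro α hα
      have hα' := hT α hα
      rw [Finset.mem_coe, Finset.mem_sigma, mem_preFiber]
      refine ⟨(hm _).2 (hα'.pow_eq (C.fr_z k)), (hm _).2 (hα'.pow_eq (S.fr_v k)), ?_⟩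
      rw [← map_qmap_iterate, S.iter, ← S.map_z, ← map_qmap_iterate, ← map_qmap_iterate]
      simp
    · intro α _ β _ he
      obtain ⟨h1, h2⟩ := Sigma.mk.inj he
      refine S.hom_ext _ _ (fun w => ?_) (eq_of_heq h2)
      rw [← S.map_z] at h1
      exact congrArg (fun t : L.A →ₐ[Ω] Ω => t w)
        (line_pt_ext p a q hq (α := α.comp S.incl) (β := β.comp S.incl) h1)
  · obtain ⟨C, ⟨S⟩⟩ := exists_iterPreimage_neg (p := p) H a ha hq hc hG₁ hG₂ hLE
      (show 0 + G + 1 ≤ j by omega) i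
    have hCE := S.embedsAway hLE (by omega)
    obtain ⟨C', ⟨S'⟩⟩ := exists_iterPreimage_neg (p := p) H a ha hq hc hG₁ hG₂ hCE
      (show j + 1 + G + 1 ≤ j' by omega) i
    obtain ⟨ψ, hψ, hψu⟩ := hCE.exists_embedding H.finite j' (by omega)
    obtain ⟨ψ', hψ', -⟩ := S'.embed ψ hψ hψu
    obtain ⟨K, hK⟩ := C'.card_pts_le (p := p) a ha hq ⟨ψ', hψ'⟩ ε hε
    refine ⟨max K 1, fun k hk => ?_⟩
    have hm := fun x => @hmem k (le_of_max_le_right hk) x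
    let T : Finset (Σ _ : Ω, Ω × Ω) := (fixedPow Ω (q ^ k)).sigma fun z =>
      preFiber c (q ^ k) (i + 1) j z ×ˢ preFiber c (q ^ k) (i + 1) j' z
    have hTc : ∑ z ∈ fixedPow Ω (q ^ k), ((preFiber c (q ^ k) (i + 1) j z).card : ℝ) *
          (preFiber c (q ^ k) (i + 1) j' z).card = T.card := by
      rw [Finset.card_sigma, Nat.cast_sum]
      refine Finset.sum_congr rfl fun z _ => ?_
      rw [Finset.card_product, Nat.cast_mul]
    rw [hTc]
    have hpt : ∀ t ∈ T, ∃ α : C'.A →ₐ[Ω] Ω, C'.IsPt k α ∧ α C'.z = t.1 ∧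
        α (S'.incl S.v) = t.2.1 ∧ α S'.v = t.2.2 := by
      rintro ⟨z, x, x'⟩ ht
      obtain ⟨hz, hxx⟩ := Finset.mem_sigma.1 ht
      obtain ⟨hx, hx'⟩ := Finset.mem_product.1 hxx
      rw [mem_preFiber] at hx hx'
      obtain ⟨β, hβ, hβz⟩ := line_exists_pt p a q hq ((hm z).1 hz)
      obtain ⟨α₁, hα₁, h1, h2⟩ := S.exists_pt k β hβ x ((hm x).1 hx.1) (by
        rw [map_neg, map_qmap_iterate, hβz]
        exact hx.2)
      have h1z : α₁ C.z = z := by rw [← S.map_z, h1, hβz]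
      obtain ⟨α₂, hα₂, h3, h4⟩ := S'.exists_pt k α₁ hα₁ x' ((hm x').1 hx'.1) (by
        rw [map_neg, map_qmap_iterate, h1z]
        exact hx'.2)
      exact ⟨α₂, hα₂, by rw [← S'.map_z, h3, h1z], by rw [h3, h2], h4⟩
    rcases T.eq_empty_or_nonempty with h0 | ⟨t₀, ht₀⟩
    · rw [h0, Finset.card_empty, Nat.cast_zero]
      positivity
    have : Nonempty (C'.A →ₐ[Ω] Ω) := ⟨(hpt t₀ ht₀).choose⟩
    choose! F hF using hpt
    have hinj : Set.InjOn F T := by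
      intro t ht t' ht' he
      obtain ⟨-, h1, h2, h3⟩ := hF t ht
      obtain ⟨-, h1', h2', h3'⟩ := hF t' ht'
      rw [← he] at h1' h2' h3'
      obtain ⟨z, x, y⟩ := t
      obtain ⟨z', x', y'⟩ := t'
      obtain rfl : z = z' := h1.symm.trans h1'
      obtain rfl : x = x' := h2.symm.trans h2'
      obtain rfl : y = y' := h3.symm.trans h3'
      rfl
    rw [← Finset.card_image_of_injOn hinj]
    refine hK k (le_of_max_le_left hk) _ fun α hα => ?_
    obtain ⟨t, ht, rfl⟩ := Finset.mem_image.1 hα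
    exact (hF t ht).1

end FrobCurve

theorem card_le_of_moments {T : Type*} [DecidableEq T] {R P : Finset T} (hP : P ⊆ R) {J : ℕ}
    (Y : ℕ → T → ℝ) {B η N Q : ℝ} (hJ : 1 ≤ J) (hη : 0 < η) (hBJ : B ^ 2 ≤ J * η ^ 2)
    (hQ : (R.card : ℝ) = Q) (hY₀ : ∀ a z, 0 ≤ Y a z) (hYB : ∀ a z, Y a z ≤ B)
    (h1 : ∀ a ∈ Finset.range J, (1 - η ^ 2 / 3) * Q ≤ ∑ z ∈ R, Y a z)
    (h2 : ∀ a ∈ Finset.range J, ∀ b ∈ Finset.range J, a ≠ b →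
      ∑ z ∈ R, Y a z * Y b z ≤ (1 + η ^ 2 / 3) * Q)
    (hN : ∀ a ∈ Finset.range J, ∑ z ∈ P, Y a z = N) :
    (P.card : ℝ) ≤ N + 2 * η * Q := by
  set A : T → ℝ := fun z => ∑ a ∈ Finset.range J, Y a z with hA
  have hQ0 : 0 ≤ Q := by rw [← hQ]; positivity
  have hJ0 : (0 : ℝ) < J := by exact_mod_cast hJ
  have hA1 : J * ((1 - η ^ 2 / 3) * Q) ≤ ∑ z ∈ R, A z := by
    rw [hA, Finset.sum_comm]
    calc _ = ∑ a ∈ Finset.range J, (1 - η ^ 2 / 3) * Q := by simp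
      _ ≤ _ := Finset.sum_le_sum h1
  have hA2 : ∑ z ∈ R, A z ^ 2 ≤ J * (J * ((1 + η ^ 2 / 3) * Q)) + J * (B ^ 2 * Q) := by
    have e : ∑ z ∈ R, A z ^ 2 =
        ∑ a ∈ Finset.range J, ∑ b ∈ Finset.range J, ∑ z ∈ R, Y a z * Y b z := by
      calc ∑ z ∈ R, A z ^ 2 =
          ∑ z ∈ R, ∑ a ∈ Finset.range J, ∑ b ∈ Finset.range J, Y a z * Y b z :=
            Finset.sum_congr rfl fun z _ => by rw [pow_two, hA, Finset.sum_mul_sum]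
        _ = _ := by
            rw [Finset.sum_comm]
            exact Finset.sum_congr rfl fun a _ => Finset.sum_comm
    rw [e]
    calc _ ≤ ∑ a ∈ Finset.range J, ∑ b ∈ Finset.range J,
          ((1 + η ^ 2 / 3) * Q + if a = b then B ^ 2 * Q else 0) := by
          refine Finset.sum_le_sum fun a ha => Finset.sum_le_sum fun b hb => ?_
          by_cases hab : a = b
          · rw [if_pos hab, ← hab]
            have : ∑ z ∈ R, Y a z * Y a z ≤ B ^ 2 * Q := by
              calc _ ≤ ∑ z ∈ R, B ^ 2 := Finset.sum_le_sum fun z _ => by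
                    rw [← pow_two]
                    exact pow_le_pow_left₀ (hY₀ a z) (hYB a z) 2
                _ = _ := by rw [Finset.sum_const, nsmul_eq_mul, hQ]; ring
            have h3 : 0 ≤ (1 + η ^ 2 / 3) * Q := by positivity
            linarith
          · rw [if_neg hab, add_zero]
            exact h2 a ha b hb hab
      _ = _ := by
          have h3 : ∀ a ∈ Finset.range J, ∑ b ∈ Finset.range J,
              ((1 + η ^ 2 / 3) * Q + if a = b then B ^ 2 * Q else 0) =
              J * ((1 + η ^ 2 / 3) * Q) + B ^ 2 * Q := by
            intro a ha
            rw [Finset.sum_add_distrib, Finset.sum_ite_eq, if_pos ha]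
            simp
          rw [Finset.sum_congr rfl h3]
          simp
  have hV : ∑ z ∈ R, (A z - J) ^ 2 ≤ 2 * (η ^ 2 * J ^ 2) * Q := by
    have e : ∑ z ∈ R, (A z - J) ^ 2 = ∑ z ∈ R, A z ^ 2 - 2 * J * ∑ z ∈ R, A z + J ^ 2 * Q := by
      have e' : ∀ z ∈ R, (A z - J) ^ 2 = A z ^ 2 - 2 * J * A z + J ^ 2 := fun z _ => by ring
      rw [Finset.sum_congr rfl e', Finset.sum_add_distrib, Finset.sum_sub_distrib,
        ← Finset.mul_sum, Finset.sum_const, nsmul_eq_mul, hQ]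
      ring
    rw [e]
    have h3 := mul_le_mul_of_nonneg_left hA1 hJ0.le
    have h4 : J * (B ^ 2 * Q) ≤ J * ((J * η ^ 2) * Q) := by gcongr
    nlinarith
  have hPV : ∑ z ∈ P, (A z - J) ^ 2 ≤ ∑ z ∈ R, (A z - J) ^ 2 :=
    Finset.sum_le_sum_of_subset_of_nonneg hP fun _ _ _ => sq_nonneg _
  have hPA : ∑ z ∈ P, A z = J * N := by
    rw [hA, Finset.sum_comm, Finset.sum_congr rfl hN]
    simp
  have hPc : (P.card : ℝ) ≤ Q := by
    rw [← hQ]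
    exact_mod_cast Finset.card_le_card hP
  have key : 2 * η * J * (J * P.card - J * N) ≤ (η * J) ^ 2 * P.card + ∑ z ∈ P, (A z - J) ^ 2 := by
    rw [← hPA]
    have e1 : 2 * η * J * (J * P.card - ∑ z ∈ P, A z) = ∑ z ∈ P, 2 * η * J * (J - A z) := by
      rw [← Finset.mul_sum, Finset.sum_sub_distrib, Finset.sum_const, nsmul_eq_mul]
      ring
    have e2 : (η * J) ^ 2 * P.card + ∑ z ∈ P, (A z - J) ^ 2 =
        ∑ z ∈ P, ((η * J) ^ 2 + (A z - J) ^ 2) := by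
      rw [Finset.sum_add_distrib, Finset.sum_const, nsmul_eq_mul]
      ring
    rw [e1, e2]
    exact Finset.sum_le_sum fun z _ => by nlinarith [sq_nonneg (η * J - (J - A z))]
  have h5 : (η * J) ^ 2 * P.card ≤ (η * J) ^ 2 * Q := by gcongr
  have h6 : (2 * η * J ^ 2) * (P.card - N) ≤ (2 * η * J ^ 2) * (2 * η * Q) := by
    have : 0 ≤ (η * J) ^ 2 * Q := by positivity
    nlinarith
  have h7 := le_of_mul_le_mul_left h6 (by positivity)
  linarith

section Periodic
variable {Ω : Type u} [Field Ω]

/-- The rational periodic points of `x ^ 2 + c`. -/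
noncomputable def perFinset (c : Ω) (Q : ℕ) : Finset Ω :=
  open Classical in (fixedPow Ω Q).filter fun z => z ∈ Function.periodicPts (qmap c : Ω → Ω)

/-- The rational points `v` with `- f^[i] v` periodic, where `f x = x ^ 2 + c`. -/
noncomputable def negPerFinset (c : Ω) (Q i : ℕ) : Finset Ω :=
  open Classical in (fixedPow Ω Q).filter fun v => -((qmap c)^[i] v) ∈ perFinset c Q

variable {c : Ω} {Q : ℕ}

theorem mem_perFinset {z : Ω} : z ∈ perFinset c Q ↔
    z ∈ fixedPow Ω Q ∧ z ∈ Function.periodicPts (qmap c : Ω → Ω) := by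
  classical
  rw [perFinset, Finset.mem_filter]

theorem mem_negPerFinset {i : ℕ} {v : Ω} : v ∈ negPerFinset c Q i ↔
    v ∈ fixedPow Ω Q ∧ -((qmap c)^[i] v) ∈ perFinset c Q := by
  classical
  rw [negPerFinset, Finset.mem_filter]

theorem iterate_mem_perFinset (hR : ∀ x ∈ fixedPow Ω Q, qmap c x ∈ fixedPow Ω Q) (j : ℕ) {z : Ω}
    (hz : z ∈ perFinset c Q) : (qmap c)^[j] z ∈ perFinset c Q := by
  rw [mem_perFinset] at hz ⊢
  exact ⟨Set.MapsTo.iterate (s := (fixedPow Ω Q : Set Ω)) hR j hz.1,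
    ((Function.bijOn_periodicPts (qmap c : Ω → Ω)).iterate j).mapsTo hz.2⟩

theorem injOn_perFinset (j : ℕ) : Set.InjOn ((qmap c : Ω → Ω)^[j]) (perFinset c Q) :=
  fun _ hx _ hy h =>
  ((Function.bijOn_periodicPts (qmap c : Ω → Ω)).iterate j).injOn
    (mem_perFinset.1 hx).2 (mem_perFinset.1 hy).2 h

theorem sum_card_preFiber (hR : ∀ x ∈ fixedPow Ω Q, qmap c x ∈ fixedPow Ω Q) (i j : ℕ) :
    ∑ z ∈ perFinset c Q, (preFiber c Q i j z).card = (negPerFinset c Q i).card := by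
  classical
  have himg : (perFinset c Q).image (qmap c)^[j] = perFinset c Q := by
    refine Finset.eq_of_subset_of_card_le ?_ ?_
    · intro x hx
      obtain ⟨z, hz, rfl⟩ := Finset.mem_image.1 hx
      exact iterate_mem_perFinset hR j hz
    · rw [Finset.card_image_of_injOn (injOn_perFinset j)]
  rw [Finset.card_eq_sum_card_fiberwise (f := fun v => -((qmap c)^[i] v)) (t := perFinset c Q)
    (fun v hv => (mem_negPerFinset.1 hv).2)]
  conv_rhs => rw [← himg, Finset.sum_image (injOn_perFinset j)]
  refine Finset.sum_congr rfl fun z hz => ?_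
  congr 1
  ext v
  rw [mem_preFiber, Finset.mem_filter, mem_negPerFinset, neg_eq_iff_eq_neg]
  constructor
  · rintro ⟨h1, h2⟩
    refine ⟨⟨h1, ?_⟩, h2⟩
    rw [h2, neg_neg]
    exact iterate_mem_perFinset hR j hz
  · rintro ⟨⟨h1, -⟩, h2⟩
    exact ⟨h1, h2⟩

theorem sum_card_negPerFinset_le (H : GoodParam c)
    (hR : ∀ x ∈ fixedPow Ω Q, qmap c x ∈ fixedPow Ω Q) (I : ℕ) :
    ∑ i ∈ Finset.Icc 1 I, (negPerFinset c Q i).card ≤ (fixedPow Ω Q).card := by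
  classical
  have hdisj : ∀ i i', i < i' → ∀ v, v ∈ negPerFinset c Q i → v ∈ negPerFinset c Q i' → 1 ≤ i →
      False := by
    intro i i' hlt v h1 h2 hi
    have h3 := (mem_negPerFinset.1 h1).2
    have h4 := (mem_negPerFinset.1 h2).2
    have h5 := iterate_mem_perFinset hR (i' - i) h3
    rw [qmap_iterate_neg _ _ (by omega), ← Function.iterate_add_apply, Nat.sub_add_cancel hlt.le]
      at h5
    set y := (qmap c)^[i'] v
    have h6 : -y = y := injOn_perFinset 1 h4 h5 (by simp [qmap_neg])
    have h7 : y = 0 := by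
      have : 2 * y = 0 := by linear_combination -h6
      exact (mul_eq_zero.1 this).resolve_left H.two_ne
    rw [h7] at h5
    obtain ⟨n, hn, h8⟩ := (mem_perFinset.1 h5).2
    exact H.ne_zero n hn h8
  rw [← Finset.card_biUnion]
  · refine Finset.card_le_card fun v hv => ?_
    obtain ⟨i, -, hi⟩ := Finset.mem_biUnion.1 hv
    exact (mem_negPerFinset.1 hi).1
  · intro i hi i' hi' hne
    rw [Function.onFun, Finset.disjoint_left]
    intro v h1 h2
    rcases Nat.lt_or_gt_of_ne hne with h | h
    · exact hdisj i i' h v h1 h2 (Finset.mem_Icc.1 hi).1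
    · exact hdisj i' i h v h2 h1 (Finset.mem_Icc.1 hi').1

theorem card_perFinset_le [IsAlgClosed Ω] {p : ℕ} [Fact p.Prime] [CharP Ω p] (H : GoodParam c)
    {q : ℕ} (a : ℕ) (ha : 1 ≤ a) (hq : q = (p ^ a) ^ 2) (hc : ∀ k, c ^ q ^ k = c) (ε : ℝ)
    (hε : 0 < ε) : ∀ᶠ k in Filter.atTop, ((perFinset c (q ^ k)).card : ℝ) ≤ ε * (q : ℝ) ^ k := by
  classical
  obtain ⟨g, hg, hmom⟩ := FrobCurve.exists_moments (p := p) H a ha hq hc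
  obtain ⟨I, hI⟩ := exists_nat_gt (2 / ε)
  have hI0 : (0 : ℝ) < I := lt_trans (by positivity) hI
  set η := ε / 4 with hη
  have hη0 : 0 < η := by positivity
  obtain ⟨J, hJ⟩ := exists_nat_gt (((2 : ℝ) ^ I) ^ 2 / η ^ 2)
  have hJ0 : (0 : ℝ) < J := lt_trans (by positivity) hJ
  have hJη : ((2 : ℝ) ^ I) ^ 2 ≤ J * η ^ 2 := (div_le_iff₀ (by positivity)).1 hJ.le
  have hε' : 0 < η ^ 2 / 3 := by positivity
  have E1 : ∀ᶠ k in Filter.atTop, ∀ i ∈ Finset.Icc 1 I, ∀ b ∈ Finset.range J,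
      (1 - η ^ 2 / 3) * (q : ℝ) ^ k ≤
        ∑ z ∈ fixedPow Ω (q ^ k), ((preFiber c (q ^ k) i (g * (b + 1)) z).card : ℝ) := by
    rw [Filter.eventually_all_finset]
    intro i hi
    rw [Filter.eventually_all_finset]
    intro b _
    exact Filter.eventually_atTop.2 ((hmom i _ (Finset.mem_Icc.1 hi).1 hε').1 _
      (Nat.le_mul_of_pos_right g (by omega)))
  have E2 : ∀ᶠ k in Filter.atTop, ∀ i ∈ Finset.Icc 1 I, ∀ b ∈ Finset.range J,
      ∀ d ∈ Finset.range J, b < d →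
      ∑ z ∈ fixedPow Ω (q ^ k), ((preFiber c (q ^ k) i (g * (b + 1)) z).card : ℝ) *
          (preFiber c (q ^ k) i (g * (d + 1)) z).card ≤ (1 + η ^ 2 / 3) * (q : ℝ) ^ k := by
    rw [Filter.eventually_all_finset]
    intro i hi
    rw [Filter.eventually_all_finset]
    intro b _
    rw [Filter.eventually_all_finset]
    intro d _
    by_cases hbd : b < d
    · simp only [hbd, true_imp_iff]
      refine Filter.eventually_atTop.2 ((hmom i _ (Finset.mem_Icc.1 hi).1 hε').2 _ _
        (Nat.le_mul_of_pos_right g (by omega)) ?_)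
      calc g * (b + 1) + g = g * (b + 2) := by ring
        _ ≤ g * (d + 1) := Nat.mul_le_mul_left g (by omega)
    · exact Filter.Eventually.of_forall fun _ h => absurd h hbd
  filter_upwards [E1, E2, Filter.eventually_ge_atTop 1] with k h1 h2 hk
  obtain ⟨hQ, hpQ⟩ := FrobCurve.one_lt_pow_of_eq_sq p a ha hq hk
  have hcard : ((fixedPow Ω (q ^ k)).card : ℝ) = (q : ℝ) ^ k := by
    rw [card_fixedPow hQ hpQ]
    push_cast
    rfl
  have hR : ∀ x ∈ fixedPow Ω (q ^ k), qmap c x ∈ fixedPow Ω (q ^ k) := by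
    intro x hx
    rw [mem_fixedPow hQ] at hx ⊢
    have hqk : q ^ k = p ^ (a * 2 * k) := by rw [hq]; ring
    rw [qmap_self_apply, hqk, add_pow_char_pow, ← hqk, hc, ← pow_mul, mul_comm, pow_mul, hx]
  have hstep : ∀ i ∈ Finset.Icc 1 I, ((perFinset c (q ^ k)).card : ℝ) ≤
      (negPerFinset c (q ^ k) i).card + 2 * η * (q : ℝ) ^ k := by
    intro i hi
    refine card_le_of_moments (R := fixedPow Ω (q ^ k)) (fun z hz => (mem_perFinset.1 hz).1)
      (J := J) (fun b z => ((preFiber c (q ^ k) i (g * (b + 1)) z).card : ℝ))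
      (by exact_mod_cast hJ0) hη0 hJη hcard (fun _ _ => Nat.cast_nonneg _) ?_ (h1 i hi) ?_ ?_
    · intro b z
      have h3 : (preFiber c (q ^ k) i (g * (b + 1)) z).card ≤ 2 ^ I :=
        (card_preFiber_le hR i _ z).trans
          (Nat.pow_le_pow_right (by norm_num) (Finset.mem_Icc.1 hi).2)
      exact_mod_cast h3
    · intro b hb d hd hbd
      rcases Nat.lt_or_gt_of_ne hbd with h | h
      · exact h2 i hi b hb d hd h
      · have := h2 i hi d hd b hb h
        simpa only [mul_comm] using this
    · intro b _
      rw [← Nat.cast_sum, sum_card_preFiber hR]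
  have hsum := Finset.sum_le_sum hstep
  rw [Finset.sum_const, Finset.sum_add_distrib, Finset.sum_const, ← Nat.cast_sum] at hsum
  simp only [Nat.card_Icc, Nat.add_sub_cancel, nsmul_eq_mul] at hsum
  have h3 : ((∑ i ∈ Finset.Icc 1 I, (negPerFinset c (q ^ k) i).card : ℕ) : ℝ) ≤ (q : ℝ) ^ k := by
    rw [← hcard]
    exact_mod_cast sum_card_negPerFinset_le H hR I
  have h4 : (2 : ℝ) ≤ I * ε := ((div_lt_iff₀ hε).1 hI).le
  have hQ0 : (0 : ℝ) ≤ (q : ℝ) ^ k := by positivity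
  have h5 := mul_le_mul_of_nonneg_right h4 hQ0
  refine le_of_mul_le_mul_left ?_ hI0
  nlinarith

end Periodic

section Conjugation

variable {F : Type*} [Field F] {p : Polynomial F}

theorem eval_eq_of_natDegree_two {Ω : Type*} [Field Ω] [Algebra F Ω] (hdeg : p.natDegree = 2)
    {γ : F} (hcrit : p.derivative.eval γ = 0) (x : Ω) :
    (p.map (algebraMap F Ω)).eval x = algebraMap F Ω (p.coeff 2) * (x - algebraMap F Ω γ) ^ 2 +
      algebraMap F Ω (p.eval γ) := by
  have hp : p = C (p.coeff 2) * X ^ 2 + C (p.coeff 1) * X + C (p.coeff 0) :=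
    eq_quadratic_of_degree_le_two (natDegree_le_iff_degree_le.1 hdeg.le)
  set a := p.coeff 2
  set b := p.coeff 1
  set e := p.coeff 0
  have h1 : 2 * a * γ + b = 0 := by
    rw [hp] at hcrit
    simp at hcrit
    linear_combination hcrit
  have h2 : p.eval γ = a * γ ^ 2 + b * γ + e := by
    rw [hp]
    simp
  have hb : b = -(2 * a * γ) := by linear_combination h1
  rw [h2, hb]
  conv_lhs => rw [hp, hb]
  have e2 : algebraMap F Ω 2 = 2 := map_ofNat _ 2
  simp [e2]
  ring

theorem ratMapP1_iterate {Ω : Type*} [Field Ω] (P : Polynomial Ω) (m : ℕ) (x : Ω) :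
    (ratMapP1 P 1)^[m] (some x) = some ((fun y => P.eval y)^[m] x) := by
  induction m generalizing x with
  | zero => rfl
  | succ m ih =>
    rw [Function.iterate_succ_apply, Function.iterate_succ_apply, ← ih]
    simp [ratMapP1]

end Conjugation

/-- The parameter of the monic centered quadratic polynomial conjugate to `p`. -/
noncomputable def centeredParam {F : Type*} [Field F] (p : Polynomial F) (γ : F) : F :=
  p.coeff 2 * (p.eval γ - γ)

section Centering

variable {F : Type*} [Field F] {p : Polynomial F} {Ω : Type*} [Field Ω] [Algebra F Ω]

theorem semiconj_centered (hdeg : p.natDegree = 2) {γ : F} (hcrit : p.derivative.eval γ = 0) :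
    Function.Semiconj (fun x : Ω => algebraMap F Ω (p.coeff 2) * (x - algebraMap F Ω γ))
      (fun x => (p.map (algebraMap F Ω)).eval x)
      (qmap (algebraMap F Ω (centeredParam p γ))) := by
  intro x
  dsimp only
  rw [eval_eq_of_natDegree_two hdeg hcrit, qmap_self_apply, centeredParam, map_mul, map_sub]
  ring

theorem coeff_two_ne_zero (hdeg : p.natDegree = 2) : p.coeff 2 ≠ 0 := by
  rw [← hdeg]
  apply leadingCoeff_ne_zero.2
  rintro rfl
  simp at hdeg

theorem mobiusConjugate_chebyshev (hdeg : p.natDegree = 2) {γ : F}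
    (hcrit : p.derivative.eval γ = 0) (hc : algebraMap F Ω (centeredParam p γ) = -2) :
    MobiusConjugate (p.map (algebraMap F Ω)) 1 (X ^ 2 - C 2) 1 := by
  refine ⟨algebraMap F Ω (p.coeff 2), -(algebraMap F Ω (p.coeff 2) * algebraMap F Ω γ), 0, 1,
    ?_, ?_⟩
  · simpa using coeff_two_ne_zero hdeg
  · rintro (_ | x)
    · have h1 : (X ^ 2 - C 2 : Polynomial Ω).natDegree = 2 := natDegree_X_pow_sub_C
      simp [mobiusMap, ratMapP1, hdeg, h1]
    · have := semiconj_centered (Ω := Ω) hdeg hcrit x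
      dsimp only at this
      rw [qmap_self_apply, hc] at this
      simp only [mobiusMap, ratMapP1, eval_one, one_ne_zero, if_false, zero_mul, zero_add, div_one,
        eval_sub, eval_pow, eval_X, eval_C, Option.some.injEq]
      linear_combination -this

theorem goodParam_centered [Finite F] (hodd : ringChar F ≠ 2) (hdeg : p.natDegree = 2) {γ : F}
    (hcrit : p.derivative.eval γ = 0)
    (hnotper : ¬ ∃ m : ℕ, 1 ≤ m ∧ (fun a : F => p.eval a)^[m] γ = γ)
    (hcheb : ¬ MobiusConjugate (p.map (algebraMap F Ω)) 1 (X ^ 2 - C 2) 1) :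
    GoodParam (algebraMap F Ω (centeredParam p γ)) where
  two_ne := by
    intro h0
    apply Ring.two_ne_zero hodd
    apply FaithfulSMul.algebraMap_injective F Ω
    rw [map_zero, ← h0]
    exact map_ofNat _ 2
  finite := by
    refine (Set.finite_range (algebraMap F Ω)).subset ?_
    rintro _ ⟨n, -, rfl⟩
    refine ⟨(qmap (centeredParam p γ))^[n] 0, ?_⟩
    induction n with
    | zero => simp
    | succ n ih =>
      rw [Function.iterate_succ_apply', Function.iterate_succ_apply', ← ih]
      simp [qmap]
  ne_zero := by
    intro n hn h0
    apply hnotper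
    refine ⟨n, hn, FaithfulSMul.algebraMap_injective F Ω ?_⟩
    have h1 := (semiconj_centered (Ω := Ω) hdeg hcrit).iterate_right n (algebraMap F Ω γ)
    rw [sub_self, mul_zero, h0] at h1
    have h2 : ∀ m, (fun x => (p.map (algebraMap F Ω)).eval x)^[m] (algebraMap F Ω γ) =
        algebraMap F Ω ((fun a : F => p.eval a)^[m] γ) := by
      intro m
      induction m with
      | zero => rfl
      | succ m ih =>
        rw [Function.iterate_succ_apply', Function.iterate_succ_apply', ih, eval_map_algebraMap,
          aeval_algebraMap_apply]
        rfl
    rw [h2] at h1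
    have h3 := (mul_eq_zero.1 h1).resolve_left (by simpa using coeff_two_ne_zero hdeg)
    exact sub_eq_zero.1 h3
  ne_neg_two := fun hc => hcheb (mobiusConjugate_chebyshev hdeg hcrit hc)

end Centering

theorem perCount_le {F : Type*} [Field F] [Fintype F] {p : Polynomial F} (hdeg : p.natDegree = 2)
    {γ : F} (hcrit : p.derivative.eval γ = 0) {k : ℕ} (hk : 1 < Fintype.card F ^ k) :
    perCount F p 1 k ≤
      (perFinset (algebraMap F (AlgebraicClosure F) (centeredParam p γ))
        (Fintype.card F ^ k)).card + 1 := by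
  set ι := algebraMap F (AlgebraicClosure F) with hι
  have ha : ι (p.coeff 2) ≠ 0 := by simpa [hι] using coeff_two_ne_zero hdeg
  have hfix : ∀ x : F, ι x ^ Fintype.card F ^ k = ι x := fun x => by
    rw [← map_pow, FiniteField.pow_card_pow]
  let g : AlgebraicClosure F → Option (AlgebraicClosure F) :=
    fun w => some (w / ι (p.coeff 2) + ι γ)
  have hsub : {α : Option (AlgebraicClosure F) |
      (α = none ∨ ∃ a : AlgebraicClosure F, α = some a ∧ a ^ Fintype.card F ^ k = a) ∧
      ∃ m : ℕ, 1 ≤ m ∧ (ratMapP1 (p.map ι) ((1 : Polynomial F).map ι))^[m] α = α} ⊆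
      insert none (g '' (perFinset (ι (centeredParam p γ)) (Fintype.card F ^ k) : Set _)) := by
    rintro α ⟨rfl | ⟨x, rfl, hx⟩, m, hm, hper⟩
    · exact Set.mem_insert _ _
    · refine Set.mem_insert_of_mem _ ⟨ι (p.coeff 2) * (x - ι γ), ?_, ?_⟩
      · rw [Finset.mem_coe, mem_perFinset, mem_fixedPow hk]
        constructor
        · have hsub : (x - ι γ) ^ Fintype.card F ^ k = x - ι γ := by
            obtain ⟨P, hP⟩ := CharP.exists F
            have hprime : P.Prime := CharP.char_is_prime F P
            obtain ⟨n, -, hn⟩ := FiniteField.card F P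
            have : Fact P.Prime := ⟨hprime⟩
            have : CharP (AlgebraicClosure F) P :=
              charP_of_injective_algebraMap (FaithfulSMul.algebraMap_injective F _) P
            have e : Fintype.card F ^ k = P ^ (n * k) := by rw [hn, pow_mul]
            rw [e, sub_pow_char_pow, ← e, hx, hfix]
          rw [mul_pow, hfix, hsub]
        · refine ⟨m, hm, ?_⟩
          rw [Polynomial.map_one, ratMapP1_iterate] at hper
          have h1 := (semiconj_centered (Ω := AlgebraicClosure F) hdeg hcrit).iterate_right m x
          rw [Option.some.inj hper] at h1
          exact h1.symm
      · simp only [g]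
        rw [mul_div_cancel_left₀ _ ha, sub_add_cancel]
  refine (Set.ncard_le_ncard hsub (((Finset.finite_toSet _).image _).insert _)).trans ?_
  refine (Set.ncard_insert_le _ _).trans (Nat.add_le_add_right ?_ 1)
  refine (Set.ncard_image_le (Finset.finite_toSet _)).trans ?_
  rw [Set.ncard_coe_finset]

theorem stmt_1 (F : Type*) [Field F] [Fintype F] (hodd : ringChar F ≠ 2)
    (hsq : ∃ r : ℕ, Fintype.card F = r ^ 2)
    (p : Polynomial F) (hdeg : p.natDegree = 2)
    (γ : F) (hcrit : p.derivative.eval γ = 0)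
    (hpre : ∃ m k : ℕ, 1 ≤ m ∧ 1 ≤ k ∧
      (fun a : F => p.eval a)^[m + k] γ = (fun a : F => p.eval a)^[m] γ)
    (hnotper : ¬ ∃ m : ℕ, 1 ≤ m ∧ (fun a : F => p.eval a)^[m] γ = γ)
    (hcheb : ¬ MobiusConjugate (p.map (algebraMap F (AlgebraicClosure F))) 1
        (X ^ 2 - C 2) 1) :
    Filter.Tendsto (fun k : ℕ =>
        (perCount F p 1 k : ℝ) / ((Fintype.card F : ℝ) ^ k + 1)) Filter.atTop (nhds 0) := by
  obtain ⟨P, hP⟩ := CharP.exists F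
  have hprime : P.Prime := CharP.char_is_prime F P
  have : Fact P.Prime := ⟨hprime⟩
  have : CharP (AlgebraicClosure F) P :=
    charP_of_injective_algebraMap (FaithfulSMul.algebraMap_injective F _) P
  have hcard1 : 1 < Fintype.card F := Fintype.one_lt_card
  obtain ⟨a, ha, hq⟩ : ∃ a, 1 ≤ a ∧ Fintype.card F = (P ^ a) ^ 2 := by
    obtain ⟨n, -, hn⟩ := FiniteField.card F P
    obtain ⟨r, hr⟩ := hsq
    obtain ⟨a, -, rfl⟩ := (Nat.dvd_prime_pow hprime).1
      (show r ∣ P ^ (n : ℕ) from hn ▸ hr ▸ dvd_pow_self r two_ne_zero)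
    refine ⟨a, Nat.one_le_iff_ne_zero.2 ?_, hr⟩
    rintro rfl
    rw [hr] at hcard1
    simp at hcard1
  have H := goodParam_centered (Ω := AlgebraicClosure F) hodd hdeg hcrit hnotper hcheb
  have hc : ∀ k, algebraMap F (AlgebraicClosure F) (centeredParam p γ) ^ Fintype.card F ^ k =
      algebraMap F (AlgebraicClosure F) (centeredParam p γ) := fun k => by
    rw [← map_pow, FiniteField.pow_card_pow]
  have hqR : (1 : ℝ) < Fintype.card F := by exact_mod_cast hcard1
  rw [Metric.tendsto_nhds]
  intro ε hε
  filter_upwards [card_perFinset_le (p := P) H a ha hq hc (ε / 2) (by positivity),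
    (tendsto_pow_atTop_atTop_of_one_lt hqR).eventually_gt_atTop (2 / ε),
    Filter.eventually_ge_atTop 1] with k h1 h2 hk
  have h3 : (perCount F p 1 k : ℝ) ≤ ε / 2 * (Fintype.card F : ℝ) ^ k + 1 := by
    refine le_trans ?_ (add_le_add_left h1 1)
    exact_mod_cast perCount_le hdeg hcrit (Nat.one_lt_pow (by omega) hcard1)
  have hQ : (0 : ℝ) < (Fintype.card F : ℝ) ^ k + 1 := by positivity
  rw [dist_zero_right, Real.norm_of_nonneg (by positivity), div_lt_iff₀ hQ]
  have h4 : 2 < (Fintype.card F : ℝ) ^ k * ε := (div_lt_iff₀ hε).1 h2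
  linarith
end

section
/- Let p be a prime with p ≡ 1 (mod 4) and let φ ∈ 𝔽_p(x) be Möbius-conjugate over 𝔽_p to the Lattès map (x² + a)/(x² − a), where a ∈ 𝔽_p satisfies a² + 1 = 0. Then the lim inf as n → ∞ of #Per(φ, ℙ¹(𝔽_{p^n}))/(p^n + 1) is at least 1/8. -/
open Polynomial

open Polynomial

section CharacterSums

variable {F : Type*} [Field F] [Fintype F] [DecidableEq F]

lemma quadraticChar_sq_eq_one_of_ne_zero {t : F} (ht : t ≠ 0) : quadraticChar F t ^ 2 = 1 := by
  rcases quadraticChar_dichotomy ht with h | h <;> simp [h]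

lemma quadraticChar_le_one (t : F) : quadraticChar F t ≤ 1 := by
  rcases eq_or_ne t 0 with rfl | ht
  · simp
  · rcases quadraticChar_dichotomy ht with h | h <;> simp [h]

lemma sum_quadraticChar_mul_sub_of_ne (hF : ringChar F ≠ 2) {u v : F} (huv : u ≠ v) :
    ∑ d : F, quadraticChar F ((u - d) * (v - d)) = -1 := by
  have huv' : u - v ≠ 0 := sub_ne_zero.2 huv
  have hinv : (quadraticChar F)⁻¹ = quadraticChar F := (quadraticChar_isQuadratic F).inv
  have hneg : quadraticChar F (-1) ^ 2 = 1 :=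
    quadraticChar_sq_eq_one_of_ne_zero (neg_ne_zero.2 one_ne_zero)
  have hJ := jacobiSum_nontrivial_inv (quadraticChar_ne_one hF)
  rw [hinv, jacobiSum] at hJ
  let e : F ≃ F := (Equiv.mulLeft₀ (u - v) huv').trans (Equiv.subLeft u)
  have he : ∀ x, e x = u - (u - v) * x := fun x ↦ rfl
  rw [← e.sum_comp]
  have key : ∀ x : F, quadraticChar F ((u - e x) * (v - e x)) =
      quadraticChar F (-1) * (quadraticChar F x * quadraticChar F (1 - x)) := by
    intro x
    have : (u - e x) * (v - e x) = (u - v) * (u - v) * (-1 * (x * (1 - x))) := by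
      rw [he]; ring
    rw [this, map_mul, map_mul, map_mul, map_mul, ← sq,
      quadraticChar_sq_eq_one_of_ne_zero huv', one_mul]
  simp_rw [key, ← Finset.mul_sum, hJ]
  linarith [sq (quadraticChar F (-1))]

lemma sum_quadraticChar_mul_sub_self (u : F) :
    ∑ d : F, quadraticChar F ((u - d) * (u - d)) = Fintype.card F - 1 := by
  have h : ∀ d : F, quadraticChar F ((u - d) * (u - d)) = 1 - if d = u then 1 else 0 := by
    intro d
    split_ifs with hd
    · simp [hd]
    · rw [map_mul, ← sq, quadraticChar_sq_eq_one_of_ne_zero (sub_ne_zero.2 (Ne.symm hd))]; simp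
  simp [h, Finset.sum_sub_distrib]

/-- The character sum attached to the curve `y² = x³ - dx`. -/
def cubicCharSum (d : F) : ℤ := ∑ x : F, quadraticChar F (x * (x ^ 2 - d))

lemma card_sqrt_le_two (hF : ringChar F ≠ 2) (d : F) :
    ((Finset.univ.filter fun t : F ↦ t ^ 2 = d).card : ℤ) ≤ 2 := by
  have h := quadraticChar_card_sqrts hF d
  have h2 : {x : F | x ^ 2 = d}.toFinset = Finset.univ.filter fun t : F ↦ t ^ 2 = d := by
    ext; simp
  rw [h2] at h
  linarith [quadraticChar_le_one d]

lemma sum_cubicCharSum_sq_le (hF : ringChar F ≠ 2) :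
    ∑ d : F, cubicCharSum d ^ 2 ≤ 2 * (Fintype.card F : ℤ) ^ 2 := by
  have h1 : ∑ d : F, cubicCharSum d ^ 2 =
      ∑ x : F, ∑ y : F, quadraticChar F (x * y) *
        ∑ d : F, quadraticChar F ((x ^ 2 - d) * (y ^ 2 - d)) := by
    simp_rw [cubicCharSum, sq (∑ x : F, _), Finset.sum_mul_sum, Finset.mul_sum]
    rw [Finset.sum_comm]
    refine Finset.sum_congr rfl fun x _ ↦ ?_
    rw [Finset.sum_comm]
    refine Finset.sum_congr rfl fun y _ ↦ Finset.sum_congr rfl fun d _ ↦ ?_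
    rw [← map_mul, ← map_mul]
    congr 1
    ring
  have h2 : ∀ x y : F, quadraticChar F (x * y) *
        ∑ d : F, quadraticChar F ((x ^ 2 - d) * (y ^ 2 - d)) =
      (if y ^ 2 = x ^ 2 then quadraticChar F (x * y) * Fintype.card F else 0)
        - quadraticChar F x * quadraticChar F y := by
    intro x y
    split_ifs with h
    · rw [h, sum_quadraticChar_mul_sub_self, map_mul]; ring
    · rw [sum_quadraticChar_mul_sub_of_ne hF (Ne.symm h), map_mul]; ring
  simp_rw [h1, h2, Finset.sum_sub_distrib, ← Finset.sum_mul_sum, quadraticChar_sum_zero hF]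
  have h3 : ∀ x : F, ∑ y : F,
      (if y ^ 2 = x ^ 2 then quadraticChar F (x * y) * (Fintype.card F : ℤ) else 0) ≤
        2 * Fintype.card F := by
    intro x
    calc _ ≤ ∑ y : F, (if y ^ 2 = x ^ 2 then (Fintype.card F : ℤ) else 0) := by
          refine Finset.sum_le_sum fun y _ ↦ ?_
          split_ifs
          · nlinarith [quadraticChar_le_one (x * y), Nat.cast_nonneg (α := ℤ) (Fintype.card F)]
          · rfl
      _ = ((Finset.univ.filter fun t : F ↦ t ^ 2 = x ^ 2).card : ℤ) * Fintype.card F := by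
          rw [← Finset.sum_filter]; simp
      _ ≤ _ := by gcongr; exact card_sqrt_le_two hF _
  calc _ ≤ ∑ _x : F, 2 * (Fintype.card F : ℤ) - 0 * 0 := by
        gcongr with x; exact h3 x
    _ = _ := by simp; ring

lemma cubicCharSum_sq_sq {t : F} (ht : t ≠ 0) :
    cubicCharSum (t ^ 2) ^ 2 = cubicCharSum (1 : F) ^ 2 := by
  have h : cubicCharSum (t ^ 2) = quadraticChar F t ^ 3 * cubicCharSum (1 : F) := by
    rw [cubicCharSum, cubicCharSum, ← Equiv.sum_comp (Equiv.mulLeft₀ t ht), Finset.mul_sum]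
    refine Finset.sum_congr rfl fun x _ ↦ ?_
    rw [← map_pow (quadraticChar F), ← map_mul (quadraticChar F)]
    congr 1
    simp only [Equiv.mulLeft₀_apply]
    ring
  rw [h, mul_pow, ← pow_mul, mul_comm 3 2, pow_mul, quadraticChar_sq_eq_one_of_ne_zero ht]
  ring

lemma cubicCharSum_one_sq_le (hF : ringChar F ≠ 2) :
    cubicCharSum (1 : F) ^ 2 ≤ 8 * Fintype.card F := by
  have h1 : ((Fintype.card F : ℤ) - 1) * cubicCharSum (1 : F) ^ 2 ≤
      ∑ t : F, cubicCharSum (t ^ 2) ^ 2 := by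
    calc _ = ∑ t : F, (if t = 0 then 0 else cubicCharSum (1 : F) ^ 2) := by
          rw [Finset.sum_ite, Finset.sum_const_zero, zero_add, Finset.sum_const,
            Finset.filter_ne', Finset.card_erase_of_mem (Finset.mem_univ _), Finset.card_univ,
            nsmul_eq_mul, Nat.cast_sub Fintype.card_pos, Nat.cast_one]
      _ ≤ _ := by
          refine Finset.sum_le_sum fun t _ ↦ ?_
          split_ifs with ht
          · positivity
          · rw [cubicCharSum_sq_sq ht]
  have h2 : ∑ t : F, cubicCharSum (t ^ 2) ^ 2 ≤ 2 * ∑ d : F, cubicCharSum d ^ 2 := by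
    rw [← Finset.sum_fiberwise (s := Finset.univ) (g := fun t : F ↦ t ^ 2), Finset.mul_sum]
    refine Finset.sum_le_sum fun d _ ↦ ?_
    calc _ = ∑ t ∈ Finset.univ.filter (fun t : F ↦ t ^ 2 = d), cubicCharSum d ^ 2 :=
          Finset.sum_congr rfl fun t ht ↦ by rw [(Finset.mem_filter.1 ht).2]
      _ ≤ _ := by
          rw [Finset.sum_const, nsmul_eq_mul]
          gcongr
          exact card_sqrt_le_two hF d
  have h3 := sum_cubicCharSum_sq_le hF
  have h4 : (2 : ℤ) ≤ Fintype.card F := by exact_mod_cast Fintype.one_lt_card (α := F)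
  nlinarith [sq_nonneg (cubicCharSum (1 : F))]

/-- Lower bound for the number of `x` such that `x`, `x - 1` and `x + 1` are all nonsquares. -/
lemma card_consecutive_nonsquares_ge (hF : ringChar F ≠ 2) :
    (Fintype.card F : ℤ) - 15 - cubicCharSum (1 : F) ≤
      8 * (Finset.univ.filter fun x : F ↦ quadraticChar F x = -1 ∧ quadraticChar F (x - 1) = -1 ∧
        quadraticChar F (x + 1) = -1).card := by
  have h2 : (2 : F) ≠ 0 := Ring.two_ne_zero hF
  have s1 := quadraticChar_sum_zero hF
  have s2 : ∑ x : F, quadraticChar F (x - 1) = 0 := by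
    rw [← s1]; exact (Equiv.subRight (1 : F)).sum_comp (quadraticChar F)
  have s3 : ∑ x : F, quadraticChar F (x + 1) = 0 := by
    rw [← s1]; exact Equiv.sum_comp (Equiv.addRight (1 : F)) (quadraticChar F)
  have s4 : ∑ x : F, quadraticChar F (x * (x - 1)) = -1 := by
    rw [← sum_quadraticChar_mul_sub_of_ne hF (zero_ne_one (α := F))]
    exact Finset.sum_congr rfl fun x _ ↦ by congr 1; ring
  have s5 : ∑ x : F, quadraticChar F (x * (x + 1)) = -1 := by
    rw [← sum_quadraticChar_mul_sub_of_ne hF (neg_ne_zero.2 (one_ne_zero (α := F))).symm]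
    exact Finset.sum_congr rfl fun x _ ↦ by congr 1; ring
  have s6 : ∑ x : F, quadraticChar F ((x - 1) * (x + 1)) = -1 := by
    have : (1 : F) ≠ -1 := fun h ↦ h2 (by linear_combination h)
    rw [← sum_quadraticChar_mul_sub_of_ne hF this]
    exact Finset.sum_congr rfl fun x _ ↦ by congr 1; ring
  have s7 : ∑ x : F, quadraticChar F (x * ((x - 1) * (x + 1))) = cubicCharSum (1 : F) :=
    Finset.sum_congr rfl fun x _ ↦ by congr 1; ring
  have total : ∑ x : F, (1 - quadraticChar F x) * (1 - quadraticChar F (x - 1)) *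
      (1 - quadraticChar F (x + 1)) = Fintype.card F - 3 - cubicCharSum (1 : F) := by
    have expand : ∀ x : F, (1 - quadraticChar F x) * (1 - quadraticChar F (x - 1)) *
      (1 - quadraticChar F (x + 1)) = 1 - quadraticChar F x - quadraticChar F (x - 1)
        - quadraticChar F (x + 1) + quadraticChar F (x * (x - 1)) + quadraticChar F (x * (x + 1))
        + quadraticChar F ((x - 1) * (x + 1)) - quadraticChar F (x * ((x - 1) * (x + 1))) := by
      intro x
      simp only [map_mul]
      ring
    simp_rw [expand, Finset.sum_sub_distrib, Finset.sum_add_distrib, Finset.sum_sub_distrib,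
      s1, s2, s3, s4, s5, s6, s7]
    simp
    ring
  have bound : ∀ x : F, (1 - quadraticChar F x) * (1 - quadraticChar F (x - 1)) *
      (1 - quadraticChar F (x + 1)) ≤ 8 * (if quadraticChar F x = -1 ∧
        quadraticChar F (x - 1) = -1 ∧ quadraticChar F (x + 1) = -1 then 1 else 0) +
        ((if x = 0 then 4 else 0) + (if x = 1 then 4 else 0) + (if x = -1 then 4 else 0)) := by
    intro x
    have hx1 : x - 1 = 0 ↔ x = 1 := sub_eq_zero
    have hx2 : x + 1 = 0 ↔ x = -1 := add_eq_zero_iff_eq_neg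
    have aux : ∀ t : F, t = 0 ∧ quadraticChar F t = 0 ∨ t ≠ 0 ∧ quadraticChar F t = 1 ∨
        t ≠ 0 ∧ quadraticChar F t = -1 := by
      intro t
      rcases eq_or_ne t 0 with rfl | ht
      · simp
      · simpa [ht] using quadraticChar_dichotomy ht
    rcases aux x with ⟨h, e⟩ | ⟨h, e⟩ | ⟨h, e⟩ <;>
      rcases aux (x - 1) with ⟨h', e'⟩ | ⟨h', e'⟩ | ⟨h', e'⟩ <;>
      rcases aux (x + 1) with ⟨h'', e''⟩ | ⟨h'', e''⟩ | ⟨h'', e''⟩ <;>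
      grind
  have := Finset.sum_le_sum fun x (_ : x ∈ Finset.univ) ↦ bound x
  rw [total, Finset.sum_add_distrib, ← Finset.mul_sum, Finset.sum_boole] at this
  simp only [Finset.sum_add_distrib, Finset.sum_ite_eq', Finset.mem_univ, if_true] at this
  linarith

end CharacterSums

section Mobius

variable {K : Type*} [Field K]

lemma mobiusMap_adjugate {a b c d : K} (h : a * d - b * c ≠ 0) (z : Option K) :
    mobiusMap d (-b) (-c) a (mobiusMap a b c d z) = z := by
  rcases z with _ | x
  · by_cases hc : c = 0
    · simp [mobiusMap, hc]
    · have : -(c * (a / c)) + a = 0 := by field_simp; ring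
      have h' : d * (a / c) + -b = (a * d - b * c) / c := by field_simp; ring
      simp [mobiusMap, hc, this]
  · by_cases hx : c * x + d = 0
    · have hc : c ≠ 0 := by
        rintro rfl
        exact h (by linear_combination (a - 0) * hx)
      have : d / -c = x := by field_simp; linear_combination -hx
      simp [mobiusMap, hx, hc, this]
    · have e1 : -c * ((a * x + b) / (c * x + d)) + a = (a * d - b * c) / (c * x + d) := by
        field_simp; ring
      have e2 : d * ((a * x + b) / (c * x + d)) + -b = (a * d - b * c) * x / (c * x + d) := by
        rw [eq_div_iff hx, add_mul, mul_assoc, div_mul_cancel₀ _ hx]; ring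
      have e3 : (a * d - b * c) / (c * x + d) ≠ 0 := div_ne_zero h hx
      simp only [mobiusMap, hx, if_false, e1, e2, e3]
      congr 1
      field_simp

lemma mobiusMap_frobenius_fixed {p : ℕ} [Fact p.Prime] [CharP K p] {n : ℕ} {a b c d : K}
    (ha : a ^ p ^ n = a) (hb : b ^ p ^ n = b) (hc : c ^ p ^ n = c) (hd : d ^ p ^ n = d) {z : K}
    (hz : z ^ p ^ n = z) :
    mobiusMap a b c d (some z) = none ∨
      ∃ y : K, mobiusMap a b c d (some z) = some y ∧ y ^ p ^ n = y := by
  by_cases h : c * z + d = 0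
  · simp [mobiusMap, h]
  · right
    refine ⟨(a * z + b) / (c * z + d), by simp [mobiusMap, h], ?_⟩
    rw [div_pow, add_pow_char_pow, add_pow_char_pow, mul_pow, mul_pow, ha, hb, hc, hd, hz]

end Mobius

section Lattes

variable {K : Type*} [Field K]

/-- When `2 * m = q - 1`, the set of `x ∈ 𝔽_q` with `x`, `x - 1` and `x + 1` all nonsquares,
the nonsquares being described by Euler's criterion. -/
def consecutiveNonsquares (K : Type*) [Field K] (m : ℕ) : Set K :=
  {x | x ^ m = -1 ∧ (x - 1) ^ m = -1 ∧ (x + 1) ^ m = -1}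

/-- The map induced on abscissas by multiplication by `1 + a` on `y² = x³ - x`, where
`a² = -1`. -/
def cmMap (a x : K) : K := (x ^ 2 - 1) / (2 * a * x)

variable {a x : K} {p n k : ℕ}

lemma consecutiveNonsquares_pow (hq : p ^ n = 4 * k + 1)
    (hx : x ∈ consecutiveNonsquares K (2 * k)) : x ^ p ^ n = x := by
  rw [hq, pow_succ, show 4 * k = 2 * k * 2 by ring, pow_mul, hx.1]
  ring

lemma pow_half_sq (hq : p ^ n = 4 * k + 1) (hx : x ≠ 0) (hxq : x ^ p ^ n = x) :
    (x ^ 2) ^ (2 * k) = 1 := by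
  rw [hq, pow_succ] at hxq
  rw [← pow_mul, show 2 * (2 * k) = 4 * k by ring]
  exact mul_right_cancel₀ hx (by rw [hxq, one_mul])

lemma consecutiveNonsquares_ne_zero (hk : k ≠ 0)
    (hx : x ∈ consecutiveNonsquares K (2 * k)) : x ≠ 0 ∧ x - 1 ≠ 0 ∧ x + 1 ≠ 0 := by
  have key : ∀ y : K, y ^ (2 * k) = -1 → y ≠ 0 := by
    rintro y hy rfl
    rw [zero_pow (by omega)] at hy
    exact neg_ne_zero.2 one_ne_zero hy.symm
  exact ⟨key _ hx.1, key _ hx.2.1, key _ hx.2.2⟩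

lemma consecutiveNonsquares_sq_ne_neg_one [Fact p.Prime] [CharP K p] (h2 : (2 : K) ≠ 0)
    (hq : p ^ n = 4 * k + 1) (hk : k ≠ 0) (hx : x ∈ consecutiveNonsquares K (2 * k)) : x ^ 2 ≠ -1 := by
  intro h
  have h1 : (1 - x) ^ p ^ n = 1 - x := by
    rw [sub_pow_char_pow, one_pow, consecutiveNonsquares_pow hq hx]
  have hx0 := (consecutiveNonsquares_ne_zero hk hx).2.1
  have h3 := pow_half_sq hq (by rwa [← neg_sub, neg_ne_zero]) h1
  rw [show (1 - x) ^ 2 = x * (x - 1) * (x + 1) by linear_combination (1 - x) * h,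
    mul_pow, mul_pow, hx.1, hx.2.1, hx.2.2] at h3
  exact h2 (by linear_combination -h3)

lemma mapsTo_cmMap [Fact p.Prime] [CharP K p] (ha : a ^ 2 = -1) (haq : a ^ p ^ n = a)
    (h2 : (2 : K) ≠ 0) (hq : p ^ n = 4 * k + 1) (hk : k ≠ 0) :
    Set.MapsTo (cmMap a) (consecutiveNonsquares K (2 * k)) (consecutiveNonsquares K (2 * k)) := by
  intro x hx
  have ha0 : a ≠ 0 := by rintro rfl; simp at ha
  obtain ⟨hx0, hx1, hx2⟩ := consecutiveNonsquares_ne_zero hk hx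
  have hxq := consecutiveNonsquares_pow hq hx
  have hi := consecutiveNonsquares_sq_ne_neg_one h2 hq hk hx
  have h2a : (2 * a) ^ (2 * k) = 1 := by
    rw [show 2 * a = (1 + a) ^ 2 by linear_combination -ha]
    refine pow_half_sq hq (fun h ↦ h2 ?_) (by rw [add_pow_char_pow, one_pow, haq])
    linear_combination (1 - a) * h + ha
  have hden : (2 * a * x) ^ (2 * k) = -1 := by rw [mul_pow, h2a, hx.1, one_mul]
  have hp : ((x + a) ^ 2) ^ (2 * k) = 1 := by
    refine pow_half_sq hq (fun h ↦ hi ?_) (by rw [add_pow_char_pow, hxq, haq])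
    linear_combination (x - a) * h + ha
  have hm : ((x - a) ^ 2) ^ (2 * k) = 1 := by
    refine pow_half_sq hq (fun h ↦ hi ?_) (by rw [sub_pow_char_pow, hxq, haq])
    linear_combination (x + a) * h + ha
  refine ⟨?_, ?_, ?_⟩
  · rw [cmMap, div_pow, hden, show x ^ 2 - 1 = (x - 1) * (x + 1) by ring, mul_pow, hx.2.1, hx.2.2]
    norm_num
  · have : cmMap a x - 1 = (x - a) ^ 2 / (2 * a * x) := by
      rw [cmMap]; field_simp; linear_combination -ha
    rw [this, div_pow, hden, hm]; norm_num
  · have : cmMap a x + 1 = (x + a) ^ 2 / (2 * a * x) := by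
      rw [cmMap]; field_simp; linear_combination -ha
    rw [this, div_pow, hden, hp]; norm_num

lemma injOn_cmMap (ha : a ^ 2 = -1) (h2 : (2 : K) ≠ 0) (hk : k ≠ 0) :
    Set.InjOn (cmMap a) (consecutiveNonsquares K (2 * k)) := by
  intro x hx y hy h
  have ha0 : a ≠ 0 := by rintro rfl; simp at ha
  obtain ⟨hx0, -, -⟩ := consecutiveNonsquares_ne_zero hk hx
  obtain ⟨hy0, -, -⟩ := consecutiveNonsquares_ne_zero hk hy
  rw [cmMap, cmMap, div_eq_div_iff (by simp [h2, ha0, hx0]) (by simp [h2, ha0, hy0])] at h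
  have h' : 2 * a * ((x - y) * (x * y + 1)) = 0 := by linear_combination h
  rcases mul_eq_zero.1 ((mul_eq_zero.1 h').resolve_left (mul_ne_zero h2 ha0)) with h | h
  · exact sub_eq_zero.1 h
  · have e : (y + 1) * x = x - 1 := by linear_combination h
    have := congrArg (· ^ (2 * k)) e
    simp only [mul_pow, hx.1, hx.2.1, hy.2.2] at this
    exact absurd (by linear_combination this) h2

lemma finite_consecutiveNonsquares (hk : k ≠ 0) :
    (consecutiveNonsquares K (2 * k)).Finite := by
  have h0 : (X ^ (2 * k) - C (-1 : K)) ≠ 0 := X_pow_sub_C_ne_zero (by omega) _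
  classical
  refine (X ^ (2 * k) - C (-1 : K)).roots.toFinset.finite_toSet.subset fun x hx ↦ ?_
  simp [h0, -map_neg, -map_one, hx.1]

/-- The conjugacy `x ↦ (1 - a x) / (x - a)` from `cmMap a` to the Lattès map. -/
lemma ratMapP1_lattes (ha : a ^ 2 = -1) (h2 : (2 : K) ≠ 0) (hx : x ≠ 0) (hxa : x ≠ a)
    (hya : cmMap a x ≠ a) :
    ratMapP1 (X ^ 2 + C a) (X ^ 2 - C a) (mobiusMap (-a) 1 1 (-a) (some x)) =
      mobiusMap (-a) 1 1 (-a) (some (cmMap a x)) := by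
  have ha0 : a ≠ 0 := by rintro rfl; simp at ha
  have hxa' : x + -a ≠ 0 := by rwa [← sub_eq_add_neg, sub_ne_zero]
  have hya' : cmMap a x + -a ≠ 0 := by rwa [← sub_eq_add_neg, sub_ne_zero]
  have h1a : 1 + a ≠ 0 := fun h ↦ h2 (by linear_combination (1 - a) * h + ha)
  have e1 : cmMap a x + -a = (x ^ 2 - 1 + 2 * x) / (2 * a * x) := by
    rw [cmMap]; field_simp; linear_combination -2 * x * ha
  have hnum : x ^ 2 - 1 + 2 * x ≠ 0 := by
    intro h; rw [e1, h, zero_div] at hya'; exact hya' rfl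
  have e2 : ((-a * x + 1) / (x + -a)) ^ 2 - a =
      -(1 + a) * (x ^ 2 - 1 + 2 * x) / (x + -a) ^ 2 := by
    field_simp
    linear_combination (x ^ 2 + 2 * x - a) * ha
  have e3 : ((-a * x + 1) / (x + -a)) ^ 2 - a ≠ 0 := by
    rw [e2]
    exact div_ne_zero (mul_ne_zero (neg_ne_zero.2 h1a) hnum) (pow_ne_zero _ hxa')
  have e4 : (((-a * x + 1) / (x + -a)) ^ 2 + a) / (((-a * x + 1) / (x + -a)) ^ 2 - a) =
      (-a * cmMap a x + 1) / (cmMap a x + -a) := by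
    have e5 : ((-a * x + 1) / (x + -a)) ^ 2 + a =
        (1 - a) * (1 + 2 * x - x ^ 2) / (x + -a) ^ 2 := by
      field_simp
      linear_combination (x ^ 2 - 2 * x + a) * ha
    have e6 : -a * cmMap a x + 1 = a * (1 + 2 * x - x ^ 2) / (2 * a * x) := by
      rw [cmMap]; field_simp; ring
    rw [e2, e1, e5, e6, div_div_div_cancel_right₀ (pow_ne_zero _ hxa'),
      div_div_div_cancel_right₀ (by simp [h2, ha0, hx]), div_eq_div_iff
        (mul_ne_zero (neg_ne_zero.2 h1a) hnum) hnum]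
    linear_combination (1 + 2 * x - x ^ 2) * (x ^ 2 - 1 + 2 * x) * ha
  simp only [mobiusMap, ratMapP1, one_mul, hxa', hya', if_false, eval_add, eval_sub, eval_pow,
    eval_X, eval_C, e3, e4]

end Lattes

section Counting

lemma card_le_ncard_consecutiveNonsquares {F K : Type*} [Field F] [Fintype F] [DecidableEq F]
    [Field K] (i : F →+* K) (hF : ringChar F ≠ 2) {k : ℕ} (hk : k ≠ 0)
    (hq : Fintype.card F = 4 * k + 1) :
    (Finset.univ.filter fun x : F ↦ quadraticChar F x = -1 ∧ quadraticChar F (x - 1) = -1 ∧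
      quadraticChar F (x + 1) = -1).card ≤ (consecutiveNonsquares K (2 * k)).ncard := by
  rw [← Set.ncard_coe_finset, ← Set.ncard_image_of_injective _ i.injective]
  refine Set.ncard_le_ncard ?_ (finite_consecutiveNonsquares hk)
  have key : ∀ y : F, quadraticChar F y = -1 → i y ^ (2 * k) = -1 := by
    intro y hy
    have h := quadraticChar_eq_pow_of_char_ne_two' hF y
    rw [hy, hq, show (4 * k + 1) / 2 = 2 * k by omega] at h
    rw [← map_pow, ← h]
    simp
  rintro _ ⟨x, hx, rfl⟩
  simp only [Finset.coe_filter, Finset.mem_univ, true_and, Set.mem_ofPred_eq] at hx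
  refine ⟨key x hx.1, ?_, ?_⟩
  · simpa using key _ hx.2.1
  · simpa using key _ hx.2.2

/-- The points of `ℙ¹` over the field with `q` elements, inside `ℙ¹(K)`. -/
def rationalPoints (K : Type*) [Field K] (q : ℕ) : Set (Option K) :=
  {α | α = none ∨ ∃ x : K, α = some x ∧ x ^ q = x}

lemma finite_rationalPoints_and_ncard_le (K : Type*) [Field K] {q : ℕ} (hq : 1 < q) :
    (rationalPoints K q).Finite ∧ (rationalPoints K q).ncard ≤ q + 1 := by
  classical
  have h0 := FiniteField.X_pow_card_sub_X_ne_zero K hq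
  have hsub : rationalPoints K q ⊆
      ↑(insert none ((X ^ q - X : K[X]).roots.toFinset.image some)) := by
    rintro _ (rfl | ⟨x, rfl, hx⟩)
    · simp
    · simp [h0, hx]
  refine ⟨(Finset.finite_toSet _).subset hsub, (Set.ncard_le_ncard hsub).trans ?_⟩
  rw [Set.ncard_coe_finset]
  refine (Finset.card_insert_le _ _).trans (Nat.succ_le_succ ?_)
  refine Finset.card_image_le.trans ((Multiset.toFinset_card_le _).trans ?_)
  exact (card_roots' _).trans (FiniteField.X_pow_card_sub_X_natDegree_eq K hq).le

lemma ncard_consecutiveNonsquares_le {K : Type*} [Field K] {P n k : ℕ} [Fact P.Prime] [CharP K P]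
    (hq : P ^ n = 4 * k + 1) (hk : k ≠ 0) (h2 : (2 : K) ≠ 0) {a A B C' D : K} (ha : a ^ 2 = -1)
    (haq : a ^ P ^ n = a) (hA : A ^ P ^ n = A) (hB : B ^ P ^ n = B) (hC : C' ^ P ^ n = C')
    (hD : D ^ P ^ n = D) (hdet : A * D - B * C' ≠ 0) (f : Option K → Option K)
    (hconj : ∀ z, ratMapP1 (X ^ 2 + C a) (X ^ 2 - C a) (mobiusMap A B C' D z) =
      mobiusMap A B C' D (f z)) :
    (consecutiveNonsquares K (2 * k)).ncard ≤
      (rationalPoints K (P ^ n) ∩ Function.periodicPts f).ncard := by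
  set S := consecutiveNonsquares K (2 * k)
  have hfin : S.Finite := finite_consecutiveNonsquares hk
  have := hfin.to_subtype
  have hmaps := mapsTo_cmMap ha haq h2 hq hk
  let g : S → S := hmaps.restrict
  have hg : Function.Injective g := hmaps.restrict_inj.2 (injOn_cmMap ha h2 hk)
  have hne : ∀ x ∈ S, x ≠ a := by
    rintro x hx rfl
    exact consecutiveNonsquares_sq_ne_neg_one h2 hq hk hx ha
  have hdet' : D * A - -B * -C' ≠ 0 := by convert hdet using 1; ring
  have hleft : ∀ z, mobiusMap A B C' D (mobiusMap D (-B) (-C') A z) = z := by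
    intro z
    simpa using mobiusMap_adjugate hdet' z
  have hdeta : -a * -a - 1 * 1 ≠ 0 := fun h ↦ h2 (by linear_combination -h + ha)
  let τ : S → Option K := fun x ↦ mobiusMap D (-B) (-C') A (mobiusMap (-a) 1 1 (-a) (some x))
  have hτ : Function.Injective τ := by
    intro x y hxy
    have h := congrArg (mobiusMap A B C' D) hxy
    simp only [τ, hleft] at h
    have h' := congrArg (mobiusMap (-a) (-1) (-1) (-a)) h
    rw [mobiusMap_adjugate hdeta, mobiusMap_adjugate hdeta] at h'
    exact Subtype.ext (Option.some_injective _ h')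
  have hsemi : Function.Semiconj τ g f := by
    intro x
    have hx0 := (consecutiveNonsquares_ne_zero hk x.2).1
    have h := ratMapP1_lattes ha h2 hx0 (hne x x.2) (hne _ (hmaps x.2))
    rw [← hleft (mobiusMap (-a) 1 1 (-a) (some x.1)), hconj] at h
    have h' := congrArg (mobiusMap D (-B) (-C') A) h
    rw [mobiusMap_adjugate hdet] at h'
    exact h'.symm
  have hneg : ∀ {y : K}, y ^ P ^ n = y → (-y) ^ P ^ n = -y := by
    intro y hy
    rw [Odd.neg_pow ⟨2 * k, by omega⟩, hy]
  rw [← Nat.card_coe_set_eq S, ← Set.ncard_univ, ← Set.ncard_image_of_injective _ hτ]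
  refine Set.ncard_le_ncard ?_ ((finite_rationalPoints_and_ncard_le K (by omega)).1.inter_of_left _)
  rintro _ ⟨x, -, rfl⟩
  constructor
  · have hx := consecutiveNonsquares_pow hq x.2
    have hxa : (1 : K) * x.1 + -a ≠ 0 := by
      rw [one_mul, ← sub_eq_add_neg, sub_ne_zero]; exact hne x x.2
    have hone : (1 : K) ^ P ^ n = 1 := one_pow _
    rcases mobiusMap_frobenius_fixed (hneg haq) hone hone (hneg haq) hx with h | ⟨y, h, hy⟩
    · simp only [mobiusMap, hxa, if_false, reduceCtorEq] at h
    · change mobiusMap D (-B) (-C') A (mobiusMap (-a) 1 1 (-a) (some x.1)) ∈ _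
      rw [h]
      exact mobiusMap_frobenius_fixed hD (hneg hB) (hneg hC) hA hy
  · obtain ⟨m, hm, hper⟩ := hg.mem_periodicPts x
    refine ⟨m, hm, ?_⟩
    have := hsemi.iterate_right m x
    rw [hper.eq] at this
    exact this.symm

lemma perCount_eq_ncard (P : ℕ) [Fact P.Prime] (p q : (ZMod P)[X]) (n : ℕ) :
    perCount (ZMod P) p q n = (rationalPoints (AlgebraicClosure (ZMod P)) (P ^ n) ∩
      Function.periodicPts (ratMapP1 (p.map (algebraMap (ZMod P) (AlgebraicClosure (ZMod P))))
        (q.map (algebraMap (ZMod P) (AlgebraicClosure (ZMod P)))))).ncard := by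
  rw [perCount, ZMod.card]
  rfl

lemma perCount_le_s2 (P : ℕ) [Fact P.Prime] (p q : (ZMod P)[X]) {n : ℕ} (hn : n ≠ 0) :
    perCount (ZMod P) p q n ≤ P ^ n + 1 := by
  have h := finite_rationalPoints_and_ncard_le (AlgebraicClosure (ZMod P))
    (Nat.one_lt_pow hn (Fact.out : P.Prime).one_lt)
  rw [perCount_eq_ncard]
  exact (Set.ncard_le_ncard Set.inter_subset_left h.1).trans h.2

lemma ncard_consecutiveNonsquares_ge {P n k : ℕ} [Fact P.Prime] (hn : n ≠ 0) (hP : P ≠ 2)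
    (hq : P ^ n = 4 * k + 1) (hk : k ≠ 0) :
    (P : ℝ) ^ n - 15 - 3 * √((P : ℝ) ^ n) ≤
      8 * (consecutiveNonsquares (AlgebraicClosure (ZMod P)) (2 * k)).ncard := by
  classical
  let F := GaloisField P n
  have := Fintype.ofFinite F
  have hcard : Fintype.card F = P ^ n := by
    rw [← Nat.card_eq_fintype_card]; exact GaloisField.card P n hn
  have hF : ringChar F ≠ 2 := fun h ↦ hP ((ringChar.eq F P).symm.trans h)
  have h1 := card_consecutive_nonsquares_ge hF
  have h2 := cubicCharSum_one_sq_le hF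
  have h3 := card_le_ncard_consecutiveNonsquares
    (IsAlgClosed.lift : F →ₐ[ZMod P] AlgebraicClosure (ZMod P)).toRingHom hF hk (hcard.trans hq)
  rw [hcard] at h1 h2
  have h1' : ((P : ℝ) ^ n) - 15 - (cubicCharSum (1 : F) : ℝ) ≤ 8 *
      (Finset.univ.filter fun x : F ↦ quadraticChar F x = -1 ∧ quadraticChar F (x - 1) = -1 ∧
        quadraticChar F (x + 1) = -1).card := by exact_mod_cast h1
  have h2' : (cubicCharSum (1 : F) : ℝ) ^ 2 ≤ 8 * (P : ℝ) ^ n := by exact_mod_cast h2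
  have h3' := (Nat.cast_le (α := ℝ)).2 h3
  have h4 : (cubicCharSum (1 : F) : ℝ) ≤ 3 * √((P : ℝ) ^ n) := by
    refine le_of_sq_le_sq ?_ (by positivity)
    rw [mul_pow, Real.sq_sqrt (by positivity)]
    linarith [show (0 : ℝ) ≤ (P : ℝ) ^ n by positivity]
  linarith

end Counting

theorem stmt_2 (P : ℕ) [Fact P.Prime] (hmod : P % 4 = 1)
    (p q : Polynomial (ZMod P)) (hco : IsCoprime p q)
    (hconj : ∃ a A B C' D : ZMod P, a ^ 2 + 1 = 0 ∧ A * D - B * C' ≠ 0 ∧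
      ∀ z : Option (AlgebraicClosure (ZMod P)),
        ratMapP1 ((X ^ 2 + C a).map (algebraMap (ZMod P) (AlgebraicClosure (ZMod P))))
            ((X ^ 2 - C a).map (algebraMap (ZMod P) (AlgebraicClosure (ZMod P))))
            (mobiusMap (algebraMap (ZMod P) (AlgebraicClosure (ZMod P)) A)
              (algebraMap (ZMod P) (AlgebraicClosure (ZMod P)) B)
              (algebraMap (ZMod P) (AlgebraicClosure (ZMod P)) C')
              (algebraMap (ZMod P) (AlgebraicClosure (ZMod P)) D) z)
          = mobiusMap (algebraMap (ZMod P) (AlgebraicClosure (ZMod P)) A)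
              (algebraMap (ZMod P) (AlgebraicClosure (ZMod P)) B)
              (algebraMap (ZMod P) (AlgebraicClosure (ZMod P)) C')
              (algebraMap (ZMod P) (AlgebraicClosure (ZMod P)) D)
              (ratMapP1 (p.map (algebraMap (ZMod P) (AlgebraicClosure (ZMod P))))
                (q.map (algebraMap (ZMod P) (AlgebraicClosure (ZMod P)))) z)) :
    (1 : ℝ) / 8 ≤ Filter.liminf (fun n : ℕ =>
        (perCount (ZMod P) p q n : ℝ) / ((P : ℝ) ^ n + 1)) Filter.atTop := by
  obtain ⟨a, A, B, C', D, ha, hdet, hconj⟩ := hconj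
  have hPp : P.Prime := Fact.out
  have hP2 : P ≠ 2 := by rintro rfl; omega
  set K := AlgebraicClosure (ZMod P)
  set i := algebraMap (ZMod P) K
  have hchar : CharP K P := charP_of_injective_algebraMap i.injective P
  have h2 : (2 : K) ≠ 0 := Ring.two_ne_zero fun h ↦ hP2 ((ringChar.eq K P).symm.trans h)
  have hfix : ∀ (n : ℕ) (c : ZMod P), i c ^ P ^ n = i c := fun n c ↦ by
    rw [← map_pow, ZMod.pow_card_pow]
  have hlower : ∀ n : ℕ, n ≠ 0 →
      (P : ℝ) ^ n - 15 - 3 * √((P : ℝ) ^ n) ≤ 8 * perCount (ZMod P) p q n := by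
    intro n hn
    have hmodn : P ^ n % 4 = 1 := by simp [Nat.pow_mod, hmod]
    have hgt := Nat.one_lt_pow hn hPp.one_lt
    obtain ⟨k, hk⟩ : ∃ k, P ^ n = 4 * k + 1 := ⟨P ^ n / 4, by omega⟩
    have hk0 : k ≠ 0 := by omega
    refine (ncard_consecutiveNonsquares_ge hn hP2 hk hk0).trans ?_
    rw [perCount_eq_ncard]
    gcongr
    refine ncard_consecutiveNonsquares_le hk hk0 h2 (a := i a) ?_ (hfix n a) (hfix n A) (hfix n B)
      (hfix n C') (hfix n D) ?_ _ ?_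
    · rw [← map_pow, eq_neg_of_add_eq_zero_left ha, map_neg, map_one]
    · rw [← map_mul, ← map_mul, ← map_sub]
      exact (map_ne_zero i).2 hdet
    · simpa only [Polynomial.map_add, Polynomial.map_sub, Polynomial.map_pow, map_X, map_C]
        using hconj
  have hpow : Filter.Tendsto (fun n : ℕ ↦ (P : ℝ) ^ n) Filter.atTop Filter.atTop :=
    tendsto_pow_atTop_atTop_of_one_lt (by exact_mod_cast hPp.one_lt)
  have hlim : Filter.Tendsto (fun n : ℕ ↦ (1 / 8 : ℝ) * (1 - 19 / √((P : ℝ) ^ n)))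
      Filter.atTop (nhds (1 / 8)) := by
    have h := (Real.tendsto_sqrt_atTop.comp hpow).const_div_atTop (19 : ℝ)
    simpa using (h.const_sub 1).const_mul (1 / 8 : ℝ)
  rw [← hlim.liminf_eq]
  refine Filter.liminf_le_liminf ?_ hlim.isBoundedUnder_ge ?_
  · filter_upwards [Filter.eventually_ne_atTop 0] with n hn
    have h := hlower n hn
    have hQ : (1 : ℝ) ≤ (P : ℝ) ^ n := one_le_pow₀ (by exact_mod_cast hPp.one_lt.le)
    set s := √((P : ℝ) ^ n) with hs
    have hs2 : s ^ 2 = (P : ℝ) ^ n := Real.sq_sqrt (by positivity)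
    have hs1 : 1 ≤ s := Real.one_le_sqrt.2 hQ
    have hs0 : 0 < s := by linarith
    rw [← hs2] at h ⊢
    rw [le_div_iff₀ (by positivity)]
    have : 1 / 8 * (1 - 19 / s) * (s ^ 2 + 1) = 1 / 8 * (s ^ 2 + 1 - 19 * s - 19 / s) := by
      field_simp; ring
    rw [this]
    have : 0 ≤ 19 / s := by positivity
    nlinarith
  · refine Filter.IsBoundedUnder.isCoboundedUnder_ge ?_
    refine Filter.isBoundedUnder_of_eventually_le (a := 1) ?_
    filter_upwards [Filter.eventually_ne_atTop 0] with n hn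
    rw [div_le_one (by positivity)]
    exact_mod_cast perCount_le_s2 P p q hn
end
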